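/- arXiv:0906.1162 — 2 statements merged into one kernel-verified Lean document; each statement's English description precedes it below -/
import Mathlib

section
/- Let 4 < p < ∞. Then there exist f ∈ L_p(ℝ) and a sequence (λ_j)_{j≥1} of distinct integers such that (f_(λ_j))_{j≥1} is an unconditional basic sequence in L_p(ℝ) and the closed linear span X of {f_(λ_j) : j ≥ 1} contains an isomorphic copy of L_p(ℝ): there exist constants 0 < c ≤ C and a linear map T : L_p(ℝ) → L_p(ℝ) with range contained in X and c‖g‖_p ≤ ‖Tg‖_p ≤ C‖g‖_p for all g ∈ L_p(ℝ). -/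
open MeasureTheory ENNReal

lemma tangent_of_deriv2_nonpos (f f1 f2 : ℝ → ℝ) (h1 : ∀ s, HasDerivAt f (f1 s) s)
    (h2 : ∀ s, HasDerivAt f1 (f2 s) s) (h : ∀ s, f2 s ≤ 0) (s : ℝ) :
    f s ≤ f 0 + f1 0 * s := by
  have hd1 : deriv f = f1 := funext fun s => (h1 s).deriv
  have anti : Antitone f1 := by
    apply antitone_of_deriv_nonpos (fun s => (h2 s).differentiableAt)
    intro s
    rw [(h2 s).deriv]; exact h s
  have hc : ConcaveOn ℝ Set.univ f := by
    apply Antitone.concaveOn_univ_of_deriv (fun s => (h1 s).differentiableAt)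
    rw [hd1]; exact anti
  rcases lt_trichotomy s 0 with hs | hs | hs
  · have := hc.le_slope_of_hasDerivAt (Set.mem_univ s) (Set.mem_univ 0) hs (h1 0)
    rw [slope_def_field, le_div_iff₀ (by linarith)] at this
    linarith
  · subst hs; simp
  · have := hc.slope_le_of_hasDerivAt (Set.mem_univ 0) (Set.mem_univ s) hs (h1 0)
    rw [slope_def_field, div_le_iff₀ (by linarith)] at this
    linarith

/-- The quadratic form in the Burkholder-type function. -/
noncomputable def bQ (q x y : ℝ) : ℝ := 2 * q * x ^ 2 + y ^ 2

noncomputable def bC (q : ℝ) : ℝ := (q + 1) * (2 * q + 1) * (4 * q + 2)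

noncomputable def bU (q x y : ℝ) : ℝ := bQ q x y ^ q * (bQ q x y - bC q * x ^ 2)

noncomputable def bP (q e x y : ℝ) : ℝ :=
  (q + 1) * bQ q x y * (4 * q * x + 2 * e * y) - 2 * bC q * x * bQ q x y
    - bC q * q * x ^ 2 * (4 * q * x + 2 * e * y)

noncomputable def bP' (q e x y : ℝ) : ℝ :=
  (q + 1) * ((4 * q * x + 2 * e * y) ^ 2 + bQ q x y * (4 * q + 2)) - 2 * bC q * bQ q x y
   - 2 * bC q * x * (4 * q * x + 2 * e * y) - 2 * bC q * q * x * (4 * q * x + 2 * e * y)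
   - bC q * q * x ^ 2 * (4 * q + 2)

lemma bineq (q e x y : ℝ) (hq : 1 < q) (he : e ^ 2 = 1) :
    (q - 1) * (4 * q * x + 2 * e * y) * bP q e x y + bQ q x y * bP' q e x y ≤ 0 := by
  have hQ : 0 ≤ bQ q x y := by unfold bQ; positivity
  set Q := bQ q x y with hQdef
  set D := 4 * q * x + 2 * e * y with hD
  have hC : 0 ≤ bC q := by unfold bC; positivity
  have hE : Q ^ 2 ≤ 2 * Q ^ 2 + 4 * q * x * Q * D + q * (q - 1) * x ^ 2 * D ^ 2
      + q * x ^ 2 * Q * (4 * q + 2) := by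
    have h1 : 0 ≤ q * (q - 1) * x ^ 2 * D ^ 2 := by
      have : 0 ≤ q - 1 := by linarith
      positivity
    have h2 : Q ≤ 2 * Q + 4 * q * x * D + q * x ^ 2 * (4 * q + 2) := by
      rw [hQdef, hD]; unfold bQ
      nlinarith [sq_nonneg (4 * q * x + e * y), sq_nonneg x, mul_nonneg (by linarith : (0:ℝ) ≤ q) (sq_nonneg x), sq_nonneg (q * x)]
    nlinarith [mul_le_mul_of_nonneg_left h2 hQ]
  have hDs : D ^ 2 ≤ 4 * (2 * q + 1) * Q := by
    have : 4 * (2 * q + 1) * Q - D ^ 2 = 8 * q * (x - e * y) ^ 2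
      + (1 - e ^ 2) * (8 * q * y ^ 2 + 4 * y ^ 2) := by
      rw [hQdef, hD]; unfold bQ; ring
    have h2 : 0 ≤ 8 * q * (x - e * y) ^ 2 := by positivity
    rw [he] at this
    linarith
  have hR : (q + 1) * Q * (q * D ^ 2 + Q * (4 * q + 2)) ≤ bC q * Q ^ 2 := by
    have : bC q * Q ^ 2 = (q + 1) * Q * (q * (4 * (2 * q + 1) * Q) + Q * (4 * q + 2)) := by
      unfold bC; ring
    rw [this]; gcongr
  have key : (q - 1) * D * bP q e x y + Q * bP' q e x y =
    (q + 1) * Q * (q * D ^ 2 + Q * (4 * q + 2)) - bC q * (2 * Q ^ 2 + 4 * q * x * Q * D + q * (q - 1) * x ^ 2 * D ^ 2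
      + q * x ^ 2 * Q * (4 * q + 2)) := by
    unfold bP bP'; rw [← hQdef, ← hD]; ring
  rw [key]
  nlinarith [mul_le_mul_of_nonneg_left hE hC]

lemma bU_tangent_aux (q e x y : ℝ) (hq : 1 < q) (he : e ^ 2 = 1) (hxy : y ≠ e * x) (s : ℝ) :
    bU q (x + s) (y + e * s) ≤ bU q x y + bQ q x y ^ (q - 1) * bP q e x y * s := by
  have hQ : ∀ s, 0 < bQ q (x + s) (y + e * s) := by
    intro s
    unfold bQ
    by_contra hcon
    have h1 : 0 ≤ 2 * q * (x + s) ^ 2 := by positivity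
    have h2 : 0 ≤ (y + e * s) ^ 2 := by positivity
    have h3 : (y + e * s) ^ 2 = 0 := by linarith
    have h4 : 2 * q * (x + s) ^ 2 = 0 := by linarith
    have h5 : y + e * s = 0 := by simpa using h3
    have h6 : x + s = 0 := by
      rcases mul_eq_zero.1 h4 with h | h
      · linarith
      · simpa using h
    apply hxy
    have : s = -x := by linarith
    rw [this] at h5; linarith
  have hdx : ∀ s, HasDerivAt (fun s => x + s) 1 s := fun s => by
    simpa using (hasDerivAt_id s).const_add x
  have hdy : ∀ s, HasDerivAt (fun s => y + e * s) e s := fun s => by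
    simpa using ((hasDerivAt_id s).const_mul e).const_add y
  have hdQ : ∀ s, HasDerivAt (fun s => bQ q (x + s) (y + e * s))
      (4 * q * (x + s) + 2 * e * (y + e * s)) s := fun s => by
    have := (((hdx s).pow 2).const_mul (2 * q)).add ((hdy s).pow 2)
    refine this.congr_deriv ?_
    simp; ring
  have hpow : ∀ (r : ℝ) s, HasDerivAt (fun s => bQ q (x + s) (y + e * s) ^ r)
      ((4 * q * (x + s) + 2 * e * (y + e * s)) * r * bQ q (x + s) (y + e * s) ^ (r - 1)) s := fun r s =>
    (hdQ s).rpow_const (Or.inl (hQ s).ne')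
  have hdD : ∀ s, HasDerivAt (fun s => 4 * q * (x + s) + 2 * e * (y + e * s)) (4 * q + 2) s := fun s => by
    have := ((hdx s).const_mul (4 * q)).add ((hdy s).const_mul (2 * e))
    refine this.congr_deriv ?_
    linear_combination 2 * he
  have main := tangent_of_deriv2_nonpos (fun s => bU q (x + s) (y + e * s))
    (fun s => bQ q (x + s) (y + e * s) ^ (q - 1) * bP q e (x + s) (y + e * s))
    (fun s => bQ q (x + s) (y + e * s) ^ (q - 2) * ((q - 1) * (4 * q * (x + s) + 2 * e * (y + e * s)) * bP q e (x + s) (y + e * s)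
      + bQ q (x + s) (y + e * s) * bP' q e (x + s) (y + e * s))) ?_ ?_ ?_ s
  · simpa using main
  · intro s
    have := (hpow q s).mul ((hdQ s).sub (((hdx s).pow 2).const_mul (bC q)))
    refine this.congr_deriv ?_
    have hq1 : bQ q (x + s) (y + e * s) ^ q = bQ q (x + s) (y + e * s) ^ (q - 1) * bQ q (x + s) (y + e * s) := by
      nth_rewrite 3 [← Real.rpow_one (bQ q (x + s) (y + e * s))]
      rw [← Real.rpow_add (hQ s)]; congr 1; ring
    rw [hq1]
    unfold bP
    simp
    ring
  · intro s
    have hP : HasDerivAt (fun s => bP q e (x + s) (y + e * s)) (bP' q e (x + s) (y + e * s)) s := by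
      have := ((((hdQ s).mul (hdD s)).const_mul (q + 1)).sub (((hdx s).mul (hdQ s)).const_mul (2 * bC q))).sub
        ((((hdx s).pow 2).mul (hdD s)).const_mul (bC q * q))
      refine (this.congr_deriv ?_).congr_of_eventuallyEq ?_
      · unfold bP'; simp; ring
      · refine Filter.Eventually.of_forall fun s => ?_
        unfold bP; simp; ring
    have := (hpow (q - 1) s).mul hP
    refine this.congr_deriv ?_
    have hq1 : bQ q (x + s) (y + e * s) ^ (q - 1) = bQ q (x + s) (y + e * s) ^ (q - 2) * bQ q (x + s) (y + e * s) := by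
      nth_rewrite 3 [← Real.rpow_one (bQ q (x + s) (y + e * s))]
      rw [← Real.rpow_add (hQ s)]; congr 1; ring
    rw [hq1]
    have : q - 1 - 1 = q - 2 := by ring
    rw [this]
    ring
  · intro s
    exact mul_nonpos_of_nonneg_of_nonpos (Real.rpow_nonneg (hQ s).le _) (bineq q e _ _ hq he)

lemma bU_tangent (q e x y : ℝ) (hq : 1 < q) (he : e ^ 2 = 1) (s : ℝ) :
    bU q (x + s) (y + e * s) ≤ bU q x y + bQ q x y ^ (q - 1) * bP q e x y * s := by
  have hd : Dense ({e * x}ᶜ : Set ℝ) := dense_compl_singleton _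
  have hcl : IsClosed {y : ℝ | bU q (x + s) (y + e * s) ≤ bU q x y + bQ q x y ^ (q - 1) * bP q e x y * s} := by
    apply isClosed_le
    · unfold bU bQ
      refine Continuous.mul (Continuous.rpow_const (by fun_prop) fun _ => Or.inr (by linarith)) (by fun_prop)
    · unfold bU bP bQ
      refine Continuous.add (Continuous.mul (Continuous.rpow_const (by fun_prop) fun _ => Or.inr (by linarith)) (by fun_prop)) (Continuous.mul (Continuous.mul (Continuous.rpow_const (by fun_prop) fun _ => Or.inr (by linarith)) (by fun_prop)) (by fun_prop))
  have : closure ({e * x}ᶜ : Set ℝ) ⊆ _ := closure_minimal (fun y hy => bU_tangent_aux q e x y hq he hy s) hcl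
  exact this (hd.closure_eq ▸ Set.mem_univ y)

/-- Existence of a Burkholder-type function. -/
lemma exists_burkholder (p : ℝ) (hp : 4 < p) : ∃ (U : ℝ → ℝ → ℝ) (C : ℝ), 0 < C ∧
    Continuous (Function.uncurry U) ∧ U 0 0 = 0 ∧
    (∀ x y, |y| ^ p ≤ 2 * U x y + C * |x| ^ p) ∧
    (∀ t e, e ^ 2 = 1 → U t (e * t) ≤ 0) ∧
    (∀ x y e, e ^ 2 = 1 → ∃ m, ∀ s, U (x + s) (y + e * s) ≤ U x y + m * s) := by
  obtain ⟨q, rfl⟩ : ∃ q, p = 2 * q + 2 := ⟨(p - 2) / 2, by ring⟩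
  have hq : 1 < q := by linarith
  have hC : 2 * q < bC q := by unfold bC; nlinarith [mul_pos (by linarith : 0 < q) (by linarith : 0 < q), mul_pos (mul_pos (by linarith : 0 < q) (by linarith : 0 < q)) (by linarith : 0 < q)]
  set c := bC q - 2 * q with hc
  have hc0 : 0 < c := by linarith
  have hU : ∀ x y, bU q x y = bQ q x y ^ q * (y ^ 2 - c * x ^ 2) := by
    intro x y; unfold bU; rw [hc]; unfold bQ; ring
  have hsq : ∀ z : ℝ, |z| ^ (2 * q + 2) = (z ^ 2) ^ q * z ^ 2 := by
    intro z
    rw [Real.rpow_add_of_nonneg (abs_nonneg z) (by linarith) (by norm_num), Real.rpow_mul (abs_nonneg z)]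
    norm_cast
    rw [sq_abs]
  refine ⟨bU q, (2 * c) ^ q * (2 * c) + 2 * c * (2 * q + 2 * c) ^ q, by positivity, ?_, ?_, ?_, ?_, ?_⟩
  · unfold bU bQ
    refine Continuous.mul (Continuous.rpow_const (by fun_prop) fun _ => Or.inr (by linarith)) (by fun_prop)
  · simp [bU, bQ]
  · intro x y
    rw [hU, hsq, hsq]
    have hQ : y ^ 2 ≤ bQ q x y := by unfold bQ; nlinarith [mul_nonneg (by linarith : (0:ℝ) ≤ q) (sq_nonneg x)]
    by_cases h : 2 * c * x ^ 2 ≤ y ^ 2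
    · have h1 : (y ^ 2) ^ q ≤ bQ q x y ^ q := Real.rpow_le_rpow (sq_nonneg _) hQ (by linarith)
      have h2 : y ^ 2 ≤ 2 * (y ^ 2 - c * x ^ 2) := by linarith
      have h3 : (y ^ 2) ^ q * y ^ 2 ≤ bQ q x y ^ q * (2 * (y ^ 2 - c * x ^ 2)) := by
        apply mul_le_mul h1 h2 (sq_nonneg _) (Real.rpow_nonneg (le_trans (sq_nonneg _) hQ) _)
      have h4 : 0 ≤ ((2 * c) ^ q * (2 * c) + 2 * c * (2 * q + 2 * c) ^ q) * ((x ^ 2) ^ q * x ^ 2) := by positivity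
      linarith
    · push Not at h
      have h1 : (y ^ 2) ^ q ≤ (2 * c) ^ q * (x ^ 2) ^ q := by
        rw [← Real.mul_rpow (by positivity) (by positivity)]
        exact Real.rpow_le_rpow (sq_nonneg _) h.le (by linarith)
      have h2 : bQ q x y ^ q ≤ (2 * q + 2 * c) ^ q * (x ^ 2) ^ q := by
        rw [← Real.mul_rpow (by positivity) (by positivity)]
        refine Real.rpow_le_rpow (le_trans (sq_nonneg _) hQ) ?_ (by linarith)
        unfold bQ; linarith
      have h3 : (y ^ 2) ^ q * y ^ 2 ≤ ((2 * c) ^ q * (x ^ 2) ^ q) * (2 * c * x ^ 2) :=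
        mul_le_mul h1 h.le (sq_nonneg _) (by positivity)
      have h4 : bQ q x y ^ q * (c * x ^ 2) ≤ ((2 * q + 2 * c) ^ q * (x ^ 2) ^ q) * (c * x ^ 2) := by gcongr
      have h5 : 0 ≤ bQ q x y ^ q * y ^ 2 := mul_nonneg (Real.rpow_nonneg (le_trans (sq_nonneg _) hQ) _) (sq_nonneg _)
      nlinarith
  · intro t e he
    unfold bU
    apply mul_nonpos_of_nonneg_of_nonpos
    · apply Real.rpow_nonneg; unfold bQ; positivity
    · unfold bQ
      have : 2 * q + 1 ≤ bC q := by
        unfold bC; nlinarith [mul_pos (by linarith : 0 < q) (by linarith : 0 < q), mul_pos (mul_pos (by linarith : 0 < q) (by linarith : 0 < q)) (by linarith : 0 < q)]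
      rw [mul_pow, he]
      nlinarith [mul_le_mul_of_nonneg_right this (sq_nonneg t)]
  · intro x y e he
    exact ⟨_, fun s => bU_tangent q e x y hq he s⟩

/-- atoms of the filtration generated by the points `q j`, `j < n`: the one containing `q n` -/
def hA (q : ℕ → ℝ) (n m : ℕ) : Set ℝ := {x | ∀ j < m, (x ≤ q j ↔ q n ≤ q j)}

open Classical in
/-- generalized Haar functions -/
noncomputable def hH (q : ℕ → ℝ) (μ : Measure ℝ) : ℕ → ℝ → ℝ
  | 0 => fun _ => 1
  | (n + 1) => fun x => if x ∈ hA q n n then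
      (if x ≤ q n then μ.real (hA q n n ∩ Set.Ioi (q n)) else -μ.real (hA q n n ∩ Set.Iic (q n))) else 0

lemma hA_meas (q : ℕ → ℝ) (n m : ℕ) : MeasurableSet (hA q n m) := by
  have : hA q n m = ⋂ j, ⋂ (_ : j < m), {x | (x ≤ q j ↔ q n ≤ q j)} := by
    ext x; simp [hA]
  rw [this]
  refine MeasurableSet.iInter fun j => MeasurableSet.iInter fun _ => ?_
  by_cases h : q n ≤ q j
  · simp only [h, iff_true]; exact measurableSet_Iic
  · simp only [h, iff_false]; exact measurableSet_Iic.compl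

lemma hA_self (q : ℕ → ℝ) (n m : ℕ) : q n ∈ hA q n m := fun _ _ => Iff.rfl

lemma hH_meas (q : ℕ → ℝ) (μ : Measure ℝ) (n : ℕ) : Measurable (hH q μ n) := by
  cases n with
  | zero => exact measurable_const
  | succ n =>
    exact Measurable.ite (hA_meas q n n) (Measurable.ite measurableSet_Iic measurable_const measurable_const) measurable_const

lemma hH_le (q : ℕ → ℝ) (μ : Measure ℝ) [IsProbabilityMeasure μ] (n : ℕ) (x : ℝ) : |hH q μ n x| ≤ 1 := by
  cases n with
  | zero => simp [hH]
  | succ n =>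
    simp only [hH]
    split_ifs
    · rw [abs_of_nonneg measureReal_nonneg]; exact measureReal_le_one
    · rw [abs_neg, abs_of_nonneg measureReal_nonneg]; exact measureReal_le_one
    · simp

lemma hH_const (q : ℕ → ℝ) (μ : Measure ℝ) (n i : ℕ) (hi : i ≤ n) (x : ℝ) (hx : x ∈ hA q n n) :
    hH q μ i x = hH q μ i (q n) := by
  cases i with
  | zero => simp [hH]
  | succ i =>
    have h1 : x ∈ hA q i i ↔ q n ∈ hA q i i := by
      unfold hA
      simp only [Set.mem_ofPred_eq]
      refine forall_congr' fun j => forall_congr' fun hj => ?_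
      rw [hx j (by omega)]
    have h2 : x ≤ q i ↔ q n ≤ q i := hx i (by omega)
    by_cases h3 : q n ∈ hA q i i <;> by_cases h4 : q n ≤ q i <;> simp [hH, h1, h2, h3, h4]

lemma hH_bdd_int {μ : Measure ℝ} [IsProbabilityMeasure μ] {f : ℝ → ℝ} (hf : Measurable f) (C : ℝ)
    (h : ∀ x, |f x| ≤ C) : Integrable f μ :=
  Integrable.of_bound hf.aestronglyMeasurable C (Filter.Eventually.of_forall h)

lemma hH_int (q : ℕ → ℝ) (μ : Measure ℝ) [IsProbabilityMeasure μ] (n : ℕ) : ∫ x, hH q μ (n + 1) x ∂μ = 0 := by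
  have : hH q μ (n + 1) = fun x =>
      (hA q n n ∩ Set.Iic (q n)).indicator (fun _ => μ.real (hA q n n ∩ Set.Ioi (q n))) x
      - (hA q n n ∩ Set.Ioi (q n)).indicator (fun _ => μ.real (hA q n n ∩ Set.Iic (q n))) x := by
    funext x
    by_cases h1 : x ∈ hA q n n <;> by_cases h2 : x ≤ q n <;>
      simp [hH, h1, h2, Set.indicator]
    simp [not_lt.2 h2]
  rw [this, integral_sub, integral_indicator_const, integral_indicator_const]
  · simp; ring
  · exact (hA_meas q n n).inter measurableSet_Ioi
  · exact (hA_meas q n n).inter measurableSet_Iic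
  · exact (integrable_const _).indicator ((hA_meas q n n).inter measurableSet_Iic)
  · exact (integrable_const _).indicator ((hA_meas q n n).inter measurableSet_Ioi)

lemma sum_bdd (H : ℕ → ℝ → ℝ) (hb : ∀ n x, |H n x| ≤ 1) (t : ℕ → ℝ) (n : ℕ) (x : ℝ) :
    |∑ i ∈ Finset.range n, t i * H i x| ≤ ∑ i ∈ Finset.range n, |t i| := by
  refine (Finset.abs_sum_le_sum_abs _ _).trans (Finset.sum_le_sum fun i _ => ?_)
  rw [abs_mul]
  exact mul_le_of_le_one_right (abs_nonneg _) (hb i x)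

lemma U_int {μ : Measure ℝ} [IsProbabilityMeasure μ] (U : ℝ → ℝ → ℝ) (hU : Continuous (Function.uncurry U))
    (X Y : ℝ → ℝ) (hX : Measurable X) (hY : Measurable Y) (a b : ℝ) (ha : ∀ x, |X x| ≤ a)
    (hb : ∀ x, |Y x| ≤ b) : Integrable (fun x => U (X x) (Y x)) μ := by
  obtain ⟨C, hC⟩ := (isCompact_Icc.prod isCompact_Icc : IsCompact (Set.Icc (-a) a ×ˢ Set.Icc (-b) b)).exists_bound_of_continuousOn hU.continuousOn
  refine hH_bdd_int (hU.measurable.comp (hX.prodMk hY)) C fun x => ?_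
  exact hC (X x, Y x) ⟨abs_le.1 (ha x), abs_le.1 (hb x)⟩

lemma zigzag (p : ℝ) (hp : 4 < p) (q : ℕ → ℝ) (μ : Measure ℝ) [IsProbabilityMeasure μ] :
    ∃ C : NNReal, ∀ (n : ℕ) (t e : ℕ → ℝ), (∀ i, e i ^ 2 = 1) →
      ∫⁻ x, ‖∑ i ∈ Finset.range n, e i * t i * hH q μ i x‖ₑ ^ p ∂μ ≤
        C * ∫⁻ x, ‖∑ i ∈ Finset.range n, t i * hH q μ i x‖ₑ ^ p ∂μ := by
  obtain ⟨U, C, hC, hUc, hU0, hUm, hUt, hUz⟩ := exists_burkholder p hp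
  refine ⟨C.toNNReal, fun n t e he => ?_⟩
  have hXm : ∀ (n : ℕ) (t : ℕ → ℝ), Measurable fun x => ∑ i ∈ Finset.range n, t i * hH q μ i x := fun n t =>
    Finset.measurable_fun_sum _ fun i _ => (hH_meas q μ i).const_mul _
  have hb := fun (t : ℕ → ℝ) n x => sum_bdd (hH q μ) (hH_le q μ) t n x
  have hUi : ∀ n, Integrable (fun x => U (∑ i ∈ Finset.range n, t i * hH q μ i x)
      (∑ i ∈ Finset.range n, e i * t i * hH q μ i x)) μ := fun n =>
    U_int U hUc _ _ (hXm n t) (hXm n (fun i => e i * t i)) _ _ (hb t n) (hb (fun i => e i * t i) n)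
  have key : ∀ n, ∫ x, U (∑ i ∈ Finset.range n, t i * hH q μ i x)
      (∑ i ∈ Finset.range n, e i * t i * hH q μ i x) ∂μ ≤ 0 := by
    intro n
    induction n with
    | zero => simp [hU0]
    | succ n ih =>
      cases n with
      | zero =>
        have := hUt (t 0) (e 0) (he 0)
        simp [hH]
        exact this
      | succ n =>
        obtain ⟨m, hm⟩ := hUz (∑ i ∈ Finset.range (n + 1), t i * hH q μ i (q n))
          (∑ i ∈ Finset.range (n + 1), e i * t i * hH q μ i (q n)) (e (n + 1)) (he _)
        have hpt : ∀ x, U (∑ i ∈ Finset.range (n + 1 + 1), t i * hH q μ i x)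
            (∑ i ∈ Finset.range (n + 1 + 1), e i * t i * hH q μ i x) ≤
            U (∑ i ∈ Finset.range (n + 1), t i * hH q μ i x)
            (∑ i ∈ Finset.range (n + 1), e i * t i * hH q μ i x) + m * t (n + 1) * hH q μ (n + 1) x := by
          intro x
          rw [Finset.sum_range_succ _ (n + 1), Finset.sum_range_succ _ (n + 1)]
          by_cases hx : x ∈ hA q n n
          · have hc : ∀ (t : ℕ → ℝ), ∑ i ∈ Finset.range (n + 1), t i * hH q μ i x =
              ∑ i ∈ Finset.range (n + 1), t i * hH q μ i (q n) := fun t =>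
              Finset.sum_congr rfl fun i hi => by
                rw [hH_const q μ n i (by simpa [Nat.lt_succ_iff] using hi) x hx]
            rw [hc t, hc fun i => e i * t i]
            have := hm (t (n + 1) * hH q μ (n + 1) x)
            rw [← mul_assoc, ← mul_assoc] at this
            exact this
          · have h0 : hH q μ (n + 1) x = 0 := by simp [hH, hx]
            simp [h0]
        calc _ ≤ ∫ x, (U (∑ i ∈ Finset.range (n + 1), t i * hH q μ i x)
            (∑ i ∈ Finset.range (n + 1), e i * t i * hH q μ i x) + m * t (n + 1) * hH q μ (n + 1) x) ∂μ := by
              refine integral_mono (hUi _) ((hUi _).add ?_) hpt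
              exact (hH_bdd_int (hH_meas q μ _) 1 (hH_le q μ _)).const_mul _
          _ ≤ 0 := by
            rw [integral_add (hUi _) ((hH_bdd_int (hH_meas q μ _) 1 (hH_le q μ _)).const_mul _),
              integral_const_mul, hH_int]
            simpa using ih
  have hp0 : 0 ≤ p := by linarith
  have hpi : ∀ (t : ℕ → ℝ), Integrable (fun x => |∑ i ∈ Finset.range n, t i * hH q μ i x| ^ p) μ := fun t =>
    U_int (fun x y => |x| ^ p) (by
      apply Continuous.rpow_const
      · fun_prop
      · intro _; right; exact hp0) _ _ (hXm n t) (hXm n t) _ _ (hb t n) (hb t n)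
  have hconv : ∀ (t : ℕ → ℝ), ∫⁻ x, ‖∑ i ∈ Finset.range n, t i * hH q μ i x‖ₑ ^ p ∂μ =
      ENNReal.ofReal (∫ x, |∑ i ∈ Finset.range n, t i * hH q μ i x| ^ p ∂μ) := fun t => by
    rw [ofReal_integral_eq_lintegral_ofReal (hpi t) (Filter.Eventually.of_forall fun x => by positivity)]
    refine lintegral_congr fun x => ?_
    rw [Real.enorm_eq_ofReal_abs, ENNReal.ofReal_rpow_of_nonneg (abs_nonneg _) hp0]
  rw [hconv t, hconv (fun i => e i * t i)]
  change _ ≤ ENNReal.ofReal C * _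
  rw [← ENNReal.ofReal_mul hC.le]
  apply ENNReal.ofReal_le_ofReal
  have := integral_mono (hpi fun i => e i * t i) (((hUi n).const_mul 2).add ((hpi t).const_mul C)) (fun x => hUm _ _)
  refine this.trans ?_
  simp only [Pi.add_apply]
  rw [integral_add ((hUi n).const_mul 2) ((hpi t).const_mul C), integral_const_mul, integral_const_mul]
  linarith [key n]

lemma Lp_top_of_Iic {P : ℝ≥0∞} [Fact (1 ≤ P)] (hP : P ≠ ∞) (μ : Measure ℝ) [IsProbabilityMeasure μ]
    (V : Submodule ℝ (Lp ℝ P μ)) (hV : IsClosed (V : Set (Lp ℝ P μ)))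
    (h1 : indicatorConstLp P MeasurableSet.univ (measure_ne_top μ _) (1 : ℝ) ∈ V)
    (h2 : ∀ a : ℚ, indicatorConstLp P (measurableSet_Iic (a := (a : ℝ))) (measure_ne_top μ _) (1 : ℝ) ∈ V) :
    V = ⊤ := by
  have key : ∀ (t : Set ℝ) (ht : MeasurableSet t), indicatorConstLp P ht (measure_ne_top μ _) (1 : ℝ) ∈ V := by
    refine MeasurableSpace.induction_on_inter (C := fun t ht => indicatorConstLp P ht (measure_ne_top μ _) (1 : ℝ) ∈ V)
      (BorelSpace.measurable_eq.trans Real.borel_eq_generateFrom_Iic_rat) Real.isPiSystem_Iic_rat ?_ ?_ ?_ ?_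
    · rw [indicatorConstLp_empty]; exact V.zero_mem
    · intro t ht
      simp only [Set.mem_iUnion, Set.mem_singleton_iff] at ht
      obtain ⟨a, rfl⟩ := ht
      exact h2 a
    · intro t ht h
      have := indicatorConstLp_disjoint_union (p := P) ht ht.compl (measure_ne_top μ _) (measure_ne_top μ _) disjoint_compl_right (1 : ℝ)
      have h3 : indicatorConstLp P (ht.union ht.compl) (measure_ne_top μ _) (1 : ℝ) = indicatorConstLp P MeasurableSet.univ (measure_ne_top μ _) (1 : ℝ) := by
        congr 1; simp
      rw [h3] at this
      exact (V.add_mem_iff_right h).1 (this ▸ h1)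
    · intro f hd hf h
      have hm : ∀ N : ℕ, MeasurableSet (⋃ i ∈ Finset.range N, f i) := fun N =>
        Finset.measurableSet_biUnion _ fun i _ => hf i
      have hN : ∀ N : ℕ, indicatorConstLp P (hm N) (measure_ne_top μ _) (1 : ℝ) ∈ V := by
        intro N
        induction N with
        | zero =>
          have : indicatorConstLp P (hm 0) (measure_ne_top μ _) (1 : ℝ) = indicatorConstLp P MeasurableSet.empty (measure_ne_top μ _) (1 : ℝ) := by
            congr 1; simp
          rw [this, indicatorConstLp_empty]; exact V.zero_mem
        | succ N ih =>
          have hdj : Disjoint (f N) (⋃ i ∈ Finset.range N, f i) := by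
            simp only [Set.disjoint_iUnion_right, Finset.mem_range]
            intro i hi
            exact hd (by omega)
          have := indicatorConstLp_disjoint_union (p := P) (hf N) (hm N) (measure_ne_top μ _) (measure_ne_top μ _) hdj (1 : ℝ)
          have h3 : indicatorConstLp P (hm (N + 1)) (measure_ne_top μ _) (1 : ℝ) = indicatorConstLp P ((hf N).union (hm N)) (measure_ne_top μ _) (1 : ℝ) := by
            congr 1
            rw [Finset.range_add_one, Finset.set_biUnion_insert]
          rw [h3, this]
          exact V.add_mem (h N) ih
      refine hV.mem_of_tendsto (b := Filter.atTop) (tendsto_indicatorConstLp_set (ht := hm) (hμt := fun N => measure_ne_top μ _) hP ?_) (Filter.Eventually.of_forall hN)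
      have heq : ∀ N : ℕ, symmDiff (⋃ i ∈ Finset.range N, f i) (⋃ i, f i) = (⋃ i, f i) \ (⋃ i ∈ Finset.range N, f i) := by
        intro N
        rw [symmDiff_def]
        have : (⋃ i ∈ Finset.range N, f i) \ (⋃ i, f i) = ∅ := by
          rw [Set.sdiff_eq_empty]
          exact Set.iUnion₂_subset fun i _ => Set.subset_iUnion f i
        rw [this]; exact Set.empty_union _
      simp only [heq]
      have := tendsto_measure_iInter_atTop (μ := μ) (s := fun N : ℕ => (⋃ i, f i) \ (⋃ i ∈ Finset.range N, f i))
        (fun N => ((MeasurableSet.iUnion hf).diff (hm N)).nullMeasurableSet) ?_ ⟨0, measure_ne_top μ _⟩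
      · have h0 : (⋂ n : ℕ, (⋃ i, f i) \ (⋃ i ∈ Finset.range n, f i)) = ∅ := by
          ext x
          simp only [Set.mem_iInter, Set.mem_sdiff, Set.mem_iUnion, Finset.mem_range, Set.mem_empty_iff_false, iff_false]
          intro hx
          obtain ⟨i, hi⟩ := (hx 0).1
          exact (hx (i + 1)).2 ⟨i, by omega, hi⟩
        rw [h0, measure_empty] at this
        exact this
      · intro a b hab
        refine Set.sdiff_subset_sdiff_right (Set.biUnion_subset_biUnion_left ?_)
        intro i; simp; omega
  rw [eq_top_iff]
  intro f _
  refine Lp.induction hP (motive := fun f => f ∈ V) ?_ ?_ ?_ f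
  · intro c s hs hμs
    have : (Lp.simpleFunc.indicatorConst P hs hμs.ne c : Lp ℝ P μ) = c • indicatorConstLp P hs (measure_ne_top μ _) (1 : ℝ) := by
      rw [Lp.simpleFunc.coe_indicatorConst]
      apply Lp.ext
      filter_upwards [indicatorConstLp_coeFn (p := P) (hs := hs) (hμs := hμs.ne) (c := c), Lp.coeFn_smul c (indicatorConstLp P hs (measure_ne_top μ _) (1 : ℝ)), indicatorConstLp_coeFn (p := P) (hs := hs) (hμs := measure_ne_top μ _) (c := (1:ℝ))] with x h1 h2 h3
      rw [h1, h2, Pi.smul_apply, h3]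
      by_cases hx : x ∈ s <;> simp [hx]
    rw [this]
    exact V.smul_mem _ (key s hs)
  · intro f g hf hg _ h1 h2
    exact V.add_mem h1 h2
  · exact hV


lemma hA_nhds (q : ℕ → ℝ) (hq : Function.Injective q) (n : ℕ) : hA q n n ∈ nhds (q n) := by
  have : ∀ᶠ x in nhds (q n), ∀ j ∈ Finset.range n, (x ≤ q j ↔ q n ≤ q j) := by
    rw [Filter.eventually_all_finset]
    intro j hj
    have hne : q n ≠ q j := fun h => by have := hq h; simp at hj; omega
    rcases lt_or_gt_of_ne hne with h | h
    · filter_upwards [Iio_mem_nhds h] with x hx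
      exact ⟨fun _ => h.le, fun _ => (Set.mem_Iio.1 hx).le⟩
    · filter_upwards [Ioi_mem_nhds h] with x hx
      exact ⟨fun h' => absurd h' (not_le.2 hx), fun h' => absurd h' (not_le.2 h)⟩
  filter_upwards [this] with x hx j hj
  exact hx j (Finset.mem_range.2 hj)

lemma hA_pos1 (q : ℕ → ℝ) (hq : Function.Injective q) (μ : Measure ℝ) [μ.IsOpenPosMeasure] (n : ℕ) : 0 < μ (hA q n n ∩ Set.Iic (q n)) := by
  obtain ⟨ε, hε, h⟩ := Metric.mem_nhds_iff.1 (hA_nhds q hq n)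
  have hsub : Set.Ioo (q n - ε) (q n) ⊆ hA q n n ∩ Set.Iic (q n) := fun x hx =>
    ⟨h (by rw [Metric.mem_ball, Real.dist_eq, abs_lt]; constructor <;> linarith [hx.1, hx.2]), hx.2.le⟩
  exact lt_of_lt_of_le (isOpen_Ioo.measure_pos μ (Set.nonempty_Ioo.2 (by linarith))) (measure_mono hsub)

lemma hA_pos2 (q : ℕ → ℝ) (hq : Function.Injective q) (μ : Measure ℝ) [μ.IsOpenPosMeasure] (n : ℕ) : 0 < μ (hA q n n ∩ Set.Ioi (q n)) := by
  obtain ⟨ε, hε, h⟩ := Metric.mem_nhds_iff.1 (hA_nhds q hq n)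
  have hsub : Set.Ioo (q n) (q n + ε) ⊆ hA q n n ∩ Set.Ioi (q n) := fun x hx =>
    ⟨h (by rw [Metric.mem_ball, Real.dist_eq, abs_lt]; constructor <;> linarith [hx.1, hx.2]), hx.1⟩
  exact lt_of_lt_of_le (isOpen_Ioo.measure_pos μ (Set.nonempty_Ioo.2 (by linarith))) (measure_mono hsub)

lemma hH_pos (q : ℕ → ℝ) (hq : Function.Injective q) (μ : Measure ℝ) [IsProbabilityMeasure μ] [μ.IsOpenPosMeasure] (p : ℝ) (hp : 0 < p) (n : ℕ) : 0 < ∫⁻ x, ‖hH q μ n x‖ₑ ^ p ∂μ := by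
  rw [lintegral_pos_iff_support ((hH_meas q μ n).enorm.pow_const p)]
  cases n with
  | zero =>
    have : (Function.support fun x => ‖hH q μ 0 x‖ₑ ^ p) = Set.univ := by
      ext x; simp [hH]
    rw [this]; simp
  | succ n =>
    refine lt_of_lt_of_le (hA_pos1 q hq μ n) (measure_mono fun x hx => ?_)
    have h2 := (ENNReal.toReal_pos (hA_pos2 q hq μ n).ne' (measure_ne_top μ _))
    have hv : hH q μ (n + 1) x = μ.real (hA q n n ∩ Set.Ioi (q n)) := by
      have h1 : x ∈ hA q n n := hx.1
      have h3 : x ≤ q n := hx.2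
      simp [hH, h1, h3]
    rw [Function.mem_support, hv]
    have : ‖μ.real (hA q n n ∩ Set.Ioi (q n))‖ₑ ≠ 0 := by
      rw [enorm_ne_zero]; exact h2.ne'
    intro h0
    rw [ENNReal.rpow_eq_zero_iff] at h0
    rcases h0 with h0 | h0
    · exact this h0.1
    · linarith [h0.2]

lemma hH_ind (q : ℕ → ℝ) (hq : Function.Injective q) (μ : Measure ℝ) [IsProbabilityMeasure μ] [μ.IsOpenPosMeasure] (n : ℕ) : (Set.Iic (q n)).indicator (fun _ => (1 : ℝ)) ∈ Submodule.span ℝ (Set.range (hH q μ)) := by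
  induction n using Nat.strong_induction_on with
  | _ n ih =>
  set W := Submodule.span ℝ (Set.range (hH q μ)) with hW
  have hone : (Set.univ : Set ℝ).indicator (fun _ => (1 : ℝ)) ∈ W := by
    have : (Set.univ : Set ℝ).indicator (fun _ => (1 : ℝ)) = hH q μ 0 := by funext x; simp [hH]
    rw [this]; exact Submodule.subset_span ⟨0, rfl⟩
  have hP : ∀ m ≤ n, ∃ lo hi : Set ℝ, IsLowerSet lo ∧ IsLowerSet hi ∧ q n ∉ lo ∧ q n ∈ hi ∧
      lo.indicator (fun _ => (1 : ℝ)) ∈ W ∧ hi.indicator (fun _ => (1 : ℝ)) ∈ W ∧ hA q n m = hi \ lo := by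
    intro m
    induction m with
    | zero =>
      intro _
      refine ⟨∅, Set.univ, isLowerSet_empty, isLowerSet_univ, by simp, by simp, ?_, hone, ?_⟩
      · rw [Set.indicator_empty]; exact W.zero_mem
      · ext x; simp [hA]
    | succ m ihm =>
      intro hm
      obtain ⟨lo, hi, h1, h2, h3, h4, h5, h6, h7⟩ := ihm (by omega)
      have hI := ih m (by omega)
      have hA' : ∀ x, x ∈ hA q n (m + 1) ↔ x ∈ hA q n m ∧ (x ≤ q m ↔ q n ≤ q m) := by
        intro x
        constructor
        · intro h; exact ⟨fun j hj => h j (by omega), h m (by omega)⟩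
        · rintro ⟨h, h'⟩ j hj
          rcases Nat.lt_succ_iff_lt_or_eq.1 hj with hj | rfl
          · exact h j hj
          · exact h'
      by_cases hc : q n ≤ q m
      · refine ⟨lo, hi ∩ Set.Iic (q m), h1, h2.inter (isLowerSet_Iic _), h3, ⟨h4, hc⟩, h5, ?_, ?_⟩
        · rcases h2.total (isLowerSet_Iic (q m)) with h | h
          · rw [Set.inter_eq_left.2 h]; exact h6
          · rw [Set.inter_eq_right.2 h]; exact hI
        · ext x; rw [hA', h7]; simp [hc]; tauto
      · refine ⟨lo ∪ Set.Iic (q m), hi, h1.union (isLowerSet_Iic _), h2, ?_, h4, ?_, h6, ?_⟩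
        · rintro (h | h)
          · exact h3 h
          · exact hc h
        · rcases h1.total (isLowerSet_Iic (q m)) with h | h
          · rw [Set.union_eq_right.2 h]; exact hI
          · rw [Set.union_eq_left.2 h]; exact h5
        · ext x; rw [hA', h7]; simp only [hc, iff_false, Set.mem_sdiff, Set.mem_union, Set.mem_Iic]; tauto
  obtain ⟨lo, hi, h1, h2, h3, h4, h5, h6, h7⟩ := hP n le_rfl
  have hlohi : lo ⊆ hi := by
    rcases h1.total h2 with h | h
    · exact h
    · exact absurd (h h4) h3
  set b := μ.real (hA q n n ∩ Set.Iic (q n)) with hb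
  set c := μ.real (hA q n n ∩ Set.Ioi (q n)) with hc
  have hb0 : 0 < b := ENNReal.toReal_pos (hA_pos1 q hq μ n).ne' (measure_ne_top μ _)
  have hc0 : 0 < c := ENNReal.toReal_pos (hA_pos2 q hq μ n).ne' (measure_ne_top μ _)
  have : (Set.Iic (q n)).indicator (fun _ => (1 : ℝ)) = lo.indicator (fun _ => (1 : ℝ)) +
      (b + c)⁻¹ • (hH q μ (n + 1) + b • (hi.indicator (fun _ => (1 : ℝ)) - lo.indicator (fun _ => (1 : ℝ)))) := by
    funext x
    have hxA : x ∈ hA q n n ↔ x ∈ hi ∧ x ∉ lo := by rw [h7]; rfl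
    have hsum : b + c ≠ 0 := by positivity
    by_cases hl : x ∈ lo
    · have hx : x ≤ q n := by
        by_contra hcon; exact h3 (h1 (not_le.1 hcon).le hl)
      have hh := hlohi hl
      simp [hl, hx, hh, hH, hxA]
    · by_cases hx : x ≤ q n
      · have hh : x ∈ hi := h2 hx h4
        simp [hl, hx, hh, hH, hxA, ← hb, ← hc]
        field_simp; ring
      · by_cases hh : x ∈ hi <;> simp [hl, hx, hh, hH, hxA, ← hb, ← hc]
  rw [this]
  exact W.add_mem h5 (W.smul_mem _ (W.add_mem (Submodule.subset_span ⟨n + 1, rfl⟩) (W.smul_mem _ (W.sub_mem h6 h5))))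

lemma hH_dense {P : ℝ≥0∞} [Fact (1 ≤ P)] (hP : P ≠ ∞) (q : ℕ → ℝ) (hq : Function.Injective q)
    (hqr : ∀ a : ℚ, ∃ n, q n = a)
    (μ : Measure ℝ) [IsProbabilityMeasure μ] [μ.IsOpenPosMeasure] (hm : ∀ n, MemLp (hH q μ n) P μ) :
    (Submodule.span ℝ (Set.range fun n => (hm n).toLp)).topologicalClosure = ⊤ := by
  have key : ∀ f ∈ Submodule.span ℝ (Set.range (hH q μ)), ∃ h : MemLp f P μ,
      h.toLp ∈ Submodule.span ℝ (Set.range fun n => (hm n).toLp) := by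
    intro f hf
    induction hf using Submodule.span_induction with
    | mem x h => obtain ⟨n, rfl⟩ := h; exact ⟨hm n, Submodule.subset_span ⟨n, rfl⟩⟩
    | zero => exact ⟨MemLp.zero, by rw [MemLp.toLp_zero]; exact Submodule.zero_mem _⟩
    | add x y _ _ hx hy =>
      obtain ⟨h1, h1'⟩ := hx
      obtain ⟨h2, h2'⟩ := hy
      exact ⟨h1.add h2, by rw [MemLp.toLp_add h1 h2]; exact Submodule.add_mem _ h1' h2'⟩
    | smul a x _ hx =>
      obtain ⟨h1, h1'⟩ := hx
      exact ⟨h1.const_smul a, by rw [MemLp.toLp_const_smul a h1]; exact Submodule.smul_mem _ _ h1'⟩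
  apply Lp_top_of_Iic hP μ _ (Submodule.isClosed_topologicalClosure _)
  · apply Submodule.le_topologicalClosure
    have : (Set.univ : Set ℝ).indicator (fun _ => (1 : ℝ)) = hH q μ 0 := by funext x; simp [hH]
    obtain ⟨h, h'⟩ := key ((Set.univ : Set ℝ).indicator (fun _ => (1 : ℝ))) (by rw [this]; exact Submodule.subset_span ⟨0, rfl⟩)
    exact h'
  · intro a
    apply Submodule.le_topologicalClosure
    obtain ⟨n, hn⟩ := hqr a
    obtain ⟨h, h'⟩ := key _ (hH_ind q hq μ n)
    rw [hn] at h
    simp only [hn] at h'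
    exact h'

lemma rpow_le_exp (p : ℝ) (hp : 0 < p) (x : ℝ) : |x| ^ p ≤ p ^ p * (Real.exp x + Real.exp (-x)) := by
  have h1 : |x| / p ≤ Real.exp (|x| / p) := by linarith [Real.add_one_le_exp (|x| / p)]
  have h2 : (|x| / p) ^ p ≤ Real.exp |x| := by
    calc (|x| / p) ^ p ≤ (Real.exp (|x| / p)) ^ p := Real.rpow_le_rpow (by positivity) h1 hp.le
      _ = Real.exp |x| := by rw [← Real.exp_mul]; congr 1; field_simp
  rw [Real.div_rpow (abs_nonneg x) hp.le, div_le_iff₀ (by positivity)] at h2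
  have h3 : Real.exp |x| ≤ Real.exp x + Real.exp (-x) := by
    rcases abs_cases x with ⟨h, _⟩ | ⟨h, _⟩ <;> rw [h] <;> linarith [Real.exp_pos x, Real.exp_pos (-x)]
  calc |x| ^ p ≤ Real.exp |x| * p ^ p := h2
    _ ≤ _ := by rw [mul_comm]; gcongr

/-- Khintchine inequality. -/
lemma khintchine {Ω : Type*} [MeasurableSpace Ω] (P : Measure Ω) [IsProbabilityMeasure P]
    (r : ℕ → Ω → ℝ) (hr : ∀ i, Measurable (r i)) (hr1 : ∀ i ω, r i ω ^ 2 = 1)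
    (hr0 : ∀ i, ∫ ω, r i ω ∂P = 0) (hind : ProbabilityTheory.iIndepFun r P) (p : ℝ) (hp : 2 < p) :
    ∃ K : NNReal, ∀ (s : Finset ℕ) (a : ℕ → ℝ),
      ENNReal.ofReal (∑ i ∈ s, a i ^ 2) ^ (p / 2) ≤ ∫⁻ ω, ‖∑ i ∈ s, a i * r i ω‖ₑ ^ p ∂P ∧
      ∫⁻ ω, ‖∑ i ∈ s, a i * r i ω‖ₑ ^ p ∂P ≤ K * ENNReal.ofReal (∑ i ∈ s, a i ^ 2) ^ (p / 2) := by
  have hrb : ∀ i ω, |r i ω| = 1 := fun i ω => by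
    have := hr1 i ω
    rw [← sq_abs] at this
    nlinarith [abs_nonneg (r i ω)]
  have hp0 : 0 < p := by linarith
  refine ⟨(p ^ p * (2 * Real.exp (1 / 2))).toNNReal, fun s a => ?_⟩
  set Z : Ω → ℝ := fun ω => ∑ i ∈ s, a i * r i ω with hZ
  have hZm : Measurable Z := Finset.measurable_sum _ fun i _ => (hr i).const_mul _
  set V := ∑ i ∈ s, a i ^ 2 with hV
  have hV0 : 0 ≤ V := Finset.sum_nonneg fun i _ => sq_nonneg _
  have hind' : ProbabilityTheory.iIndepFun (fun i ω => a i * r i ω) P :=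
    hind.comp (fun i x => a i * x) (fun i => measurable_const_mul _)
  constructor
  · have hm2 : ∀ i, MemLp (fun ω => a i * r i ω) 2 P := fun i =>
      MemLp.of_bound ((hr i).const_mul _).aestronglyMeasurable |a i| (Filter.Eventually.of_forall fun ω => by
        rw [Real.norm_eq_abs, abs_mul, hrb, mul_one])
    have hvar := ProbabilityTheory.IndepFun.variance_sum (μ := P) (s := s) (X := fun i ω => a i * r i ω) (fun i _ => hm2 i)
      (fun i _ j _ hij => hind'.indepFun hij)
    have hZe : (∑ i ∈ s, fun ω => a i * r i ω) = Z := by funext ω; simp [hZ]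
    rw [hZe] at hvar
    have hZ2 : MemLp Z 2 P := by rw [← hZe]; exact memLp_finsetSum' _ fun i _ => hm2 i
    have hmean : ∀ i, ∫ ω, a i * r i ω ∂P = 0 := fun i => by rw [integral_const_mul, hr0, mul_zero]
    have hZ0 : ∫ ω, Z ω ∂P = 0 := by
      rw [hZ, integral_finsetSum _ fun i _ => (hm2 i).integrable (by norm_num)]
      exact Finset.sum_eq_zero fun i _ => hmean i
    rw [ProbabilityTheory.variance_eq_sub hZ2, hZ0] at hvar
    have : ∀ i ∈ s, ProbabilityTheory.variance (fun ω => a i * r i ω) P = a i ^ 2 := by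
      intro i _
      rw [ProbabilityTheory.variance_eq_sub (hm2 i), hmean]
      simp only [Pi.pow_apply, mul_pow, hr1, mul_one]
      simp
    rw [Finset.sum_congr rfl this] at hvar
    have hE : ∫ ω, Z ω ^ 2 ∂P = V := by simpa using hvar
    have hE2 : ∫⁻ ω, ‖Z ω‖ₑ ^ (2 : ℝ) ∂P = ENNReal.ofReal V := by
      rw [← hE, ofReal_integral_eq_lintegral_ofReal hZ2.integrable_sq (Filter.Eventually.of_forall fun _ => sq_nonneg _)]
      refine lintegral_congr fun ω => ?_
      rw [← ofReal_norm, ENNReal.ofReal_rpow_of_nonneg (norm_nonneg _) (by norm_num)]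
      norm_num
    have hle := eLpNorm'_le_eLpNorm'_of_exponent_le (μ := P) (f := Z) (p := 2) (q := p) (by norm_num) hp.le hZm.aestronglyMeasurable
    rw [eLpNorm'_eq_lintegral_enorm, eLpNorm'_eq_lintegral_enorm, hE2] at hle
    have := ENNReal.rpow_le_rpow hle hp0.le
    rw [← ENNReal.rpow_mul, ← ENNReal.rpow_mul, one_div_mul_cancel hp0.ne', ENNReal.rpow_one] at this
    convert this using 2
    ring
  · rcases hV0.eq_or_lt with h0 | hpos
    · have hz : ∀ i ∈ s, a i = 0 := fun i hi => by
        have := (Finset.sum_eq_zero_iff_of_nonneg (fun i _ => sq_nonneg (a i))).1 h0.symm i hi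
        simpa using this
      have hZ0 : ∀ ω, Z ω = 0 := fun ω => Finset.sum_eq_zero fun i hi => by rw [hz i hi, zero_mul]
      have : ∫⁻ ω, ‖Z ω‖ₑ ^ p ∂P = 0 := by
        simp only [hZ0]; simp [hp0]
      rw [this]; exact zero_le
    · have hsub : ProbabilityTheory.HasSubgaussianMGF Z (V.toNNReal) P := by
        have h := ProbabilityTheory.HasSubgaussianMGF.sum_of_iIndepFun hind' (s := s)
          (c := fun i => (a i ^ 2).toNNReal) (fun i _ => by
            have h1 := ProbabilityTheory.hasSubgaussianMGF_of_mem_Icc_of_integral_eq_zero (μ := P) (a := -1) (b := 1) (hr i).aemeasurable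
              (Filter.Eventually.of_forall fun ω => abs_le.1 (hrb i ω).le) (hr0 i)
            have h2 := h1.const_mul (a i)
            convert h2 using 1
            ext
            norm_num [sq_nonneg]
            exact (mul_one (a i ^ 2)).symm)
        convert h using 1
        rw [hV, Real.toNNReal_sum_of_nonneg fun i _ => sq_nonneg _]
      set σ := Real.sqrt V with hσ
      have hσ0 : 0 < σ := Real.sqrt_pos.2 hpos
      have hσ2 : σ ^ 2 = V := Real.sq_sqrt hV0
      have hb : ∀ t : ℝ, t ^ 2 = V⁻¹ → ∫ ω, Real.exp (t * Z ω) ∂P ≤ Real.exp (1 / 2) := by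
        intro t ht
        have := hsub.mgf_le t
        rw [ht, Real.coe_toNNReal _ hV0, mul_inv_cancel₀ hpos.ne'] at this
        exact this
      have hi1 := hsub.integrable_exp_mul σ⁻¹
      have hi2 := hsub.integrable_exp_mul (-σ⁻¹)
      have hb1 := hb σ⁻¹ (by rw [inv_pow, hσ2])
      have hb2 := hb (-σ⁻¹) (by rw [neg_sq, inv_pow, hσ2])
      have hpt : ∀ ω, ‖Z ω‖ₑ ^ p ≤ ENNReal.ofReal (σ ^ p * (p ^ p * (Real.exp (σ⁻¹ * Z ω) + Real.exp (-σ⁻¹ * Z ω)))) := by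
        intro ω
        rw [← ofReal_norm, ENNReal.ofReal_rpow_of_nonneg (norm_nonneg _) hp0.le]
        apply ENNReal.ofReal_le_ofReal
        have h := rpow_le_exp p hp0 (σ⁻¹ * Z ω)
        rw [abs_mul, abs_of_pos (inv_pos.2 hσ0), Real.mul_rpow (by positivity) (abs_nonneg _), Real.inv_rpow hσ0.le,
          inv_mul_le_iff₀ (by positivity)] at h
        rw [Real.norm_eq_abs, neg_mul]
        exact h
      calc ∫⁻ ω, ‖Z ω‖ₑ ^ p ∂P ≤ ∫⁻ ω, ENNReal.ofReal (σ ^ p * (p ^ p * (Real.exp (σ⁻¹ * Z ω) + Real.exp (-σ⁻¹ * Z ω)))) ∂P :=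
            lintegral_mono hpt
        _ = ENNReal.ofReal (∫ ω, (σ ^ p * (p ^ p * (Real.exp (σ⁻¹ * Z ω) + Real.exp (-σ⁻¹ * Z ω)))) ∂P) := by
            refine (ofReal_integral_eq_lintegral_ofReal (((hi1.add hi2).const_mul _).const_mul _)
              (Filter.Eventually.of_forall fun ω => ?_)).symm
            simp only [Pi.add_apply, Pi.zero_apply]
            positivity
        _ ≤ ENNReal.ofReal (σ ^ p * (p ^ p * (2 * Real.exp (1 / 2)))) := by
            apply ENNReal.ofReal_le_ofReal
            rw [integral_const_mul, integral_const_mul, integral_add hi1 hi2]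
            gcongr
            linarith
        _ = _ := by
            rw [mul_comm, ENNReal.ofReal_mul (by positivity), ENNReal.ofReal_rpow_of_nonneg hV0 (by positivity)]
            congr 2
            rw [hσ, Real.sqrt_eq_rpow, ← Real.rpow_mul hV0]
            congr 1; ring

/-- The fair coin measure on sequences of signs. -/
noncomputable def coinM : Measure (ℕ → Bool) := Measure.infinitePi (fun _ => (PMF.uniformOfFintype Bool).toMeasure)

instance : IsProbabilityMeasure coinM := by unfold coinM; infer_instance

/-- Rademacher functions. -/
noncomputable def rd (i : ℕ) (ω : ℕ → Bool) : ℝ := if ω i then 1 else -1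

lemma rd_sq (i ω) : rd i ω ^ 2 = 1 := by unfold rd; split_ifs <;> norm_num

lemma rd_meas (i) : Measurable (rd i) :=
  (measurable_of_countable (fun b : Bool => if b then (1 : ℝ) else -1)).comp (measurable_pi_apply i)

lemma rd_int (i) : ∫ ω, rd i ω ∂coinM = 0 := by
  have h : Measure.map (fun ω : ℕ → Bool => ω i) coinM = (PMF.uniformOfFintype Bool).toMeasure :=
    Measure.infinitePi_map_eval _ i
  have h2 : ∫ ω, rd i ω ∂coinM = ∫ b, (if b then (1 : ℝ) else -1) ∂(Measure.map (fun ω : ℕ → Bool => ω i) coinM) := by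
    rw [integral_map (measurable_pi_apply i).aemeasurable (measurable_of_countable _).aestronglyMeasurable]; rfl
  rw [h2, h, PMF.integral_eq_sum]
  simp

lemma rd_indep : ProbabilityTheory.iIndepFun rd coinM :=
  ProbabilityTheory.iIndepFun_infinitePi (X := fun _ (b : Bool) => if b then (1 : ℝ) else -1) (fun _ => measurable_of_countable _)

lemma rd_khintchine (p : ℝ) (hp : 2 < p) :
    ∃ K : NNReal, ∀ (s : Finset ℕ) (a : ℕ → ℝ),
      ENNReal.ofReal (∑ i ∈ s, a i ^ 2) ^ (p / 2) ≤ ∫⁻ ω, ‖∑ i ∈ s, a i * rd i ω‖ₑ ^ p ∂coinM ∧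
      ∫⁻ ω, ‖∑ i ∈ s, a i * rd i ω‖ₑ ^ p ∂coinM ≤ K * ENNReal.ofReal (∑ i ∈ s, a i ^ 2) ^ (p / 2) :=
  khintchine coinM rd rd_meas rd_sq rd_int rd_indep p hp

/-- Square function estimate for the Haar system. -/
lemma haar_sq (p : ℝ) (hp : 4 < p) (q : ℕ → ℝ) (μ : Measure ℝ) [IsProbabilityMeasure μ] :
    ∃ K : NNReal, ∀ (n : ℕ) (t : ℕ → ℝ),
      ∫⁻ x, ENNReal.ofReal (∑ i ∈ Finset.range n, (t i * hH q μ i x) ^ 2) ^ (p / 2) ∂μ ≤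
        K * ∫⁻ x, ‖∑ i ∈ Finset.range n, t i * hH q μ i x‖ₑ ^ p ∂μ ∧
      ∫⁻ x, ‖∑ i ∈ Finset.range n, t i * hH q μ i x‖ₑ ^ p ∂μ ≤
        K * ∫⁻ x, ENNReal.ofReal (∑ i ∈ Finset.range n, (t i * hH q μ i x) ^ 2) ^ (p / 2) ∂μ := by
  obtain ⟨C, hC⟩ := zigzag p hp q μ
  obtain ⟨K, hK⟩ := rd_khintchine p (by linarith)
  refine ⟨C + C * K, fun n t => ?_⟩
  set A := ∫⁻ x, ENNReal.ofReal (∑ i ∈ Finset.range n, (t i * hH q μ i x) ^ 2) ^ (p / 2) ∂μ with hA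
  set B := ∫⁻ x, ‖∑ i ∈ Finset.range n, t i * hH q μ i x‖ₑ ^ p ∂μ with hB
  set D := ∫⁻ x, ∫⁻ ω, ‖∑ i ∈ Finset.range n, (t i * hH q μ i x) * rd i ω‖ₑ ^ p ∂coinM ∂μ with hD
  have hAD : A ≤ D := lintegral_mono fun x => (hK _ _).1
  have hDA : D ≤ K * A := by
    rw [hA, ← lintegral_const_mul' _ _ ENNReal.coe_ne_top]
    exact lintegral_mono fun x => (hK _ _).2
  have hmeas : Measurable fun z : ℝ × (ℕ → Bool) => ‖∑ i ∈ Finset.range n, (t i * hH q μ i z.1) * rd i z.2‖ₑ ^ p := by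
    refine (Measurable.enorm (Finset.measurable_sum _ fun i _ => ?_)).pow_const _
    exact (((hH_meas q μ i).comp measurable_fst).const_mul _).mul ((rd_meas i).comp measurable_snd)
  have hswap : D = ∫⁻ ω, ∫⁻ x, ‖∑ i ∈ Finset.range n, (t i * hH q μ i x) * rd i ω‖ₑ ^ p ∂μ ∂coinM :=
    lintegral_lintegral_swap hmeas.aemeasurable
  have hDB : D ≤ C * B := by
    rw [hswap]
    calc _ ≤ ∫⁻ ω, C * B ∂coinM := lintegral_mono fun ω => by
          convert hC n t (fun i => rd i ω) (fun i => rd_sq i ω) using 6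
          ring
      _ = _ := by simp
  have hBD : B ≤ C * D := by
    rw [hswap, ← lintegral_const_mul' _ _ ENNReal.coe_ne_top]
    calc B = ∫⁻ ω, B ∂coinM := by simp
      _ ≤ _ := lintegral_mono fun ω => by
          have := hC n (fun i => rd i ω * t i) (fun i => rd i ω) (fun i => rd_sq i ω)
          have h2 : ∀ i, rd i ω * (rd i ω * t i) = t i := fun i => by
            rw [← mul_assoc, ← sq, rd_sq, one_mul]
          simp only [h2] at this
          refine this.trans (le_of_eq ?_)
          congr 6
          funext x
          congr 3
          funext i
          ring
  push_cast
  constructor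
  · exact (hAD.trans hDB).trans (by gcongr; exact le_self_add)
  · calc B ≤ C * (K * A) := hBD.trans (by gcongr)
      _ = C * K * A := by rw [mul_assoc]
      _ ≤ _ := by gcongr; exact le_add_self

lemma pow3_sidon_aux {a b c d : ℕ} (hab : a ≤ b) (hcd : c ≤ d) (h : 3 ^ a + 3 ^ b = 3 ^ c + 3 ^ d) : a = c ∧ b = d := by
  have h1 : 3 ^ a ≤ 3 ^ b := Nat.pow_le_pow_right (by norm_num) hab
  have h2 : 3 ^ c ≤ 3 ^ d := Nat.pow_le_pow_right (by norm_num) hcd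
  have pa : 0 < 3 ^ a := by positivity
  have pc : 0 < 3 ^ c := by positivity
  have hbd : b = d := by
    rcases lt_trichotomy b d with hlt | heq | hlt
    · have : 3 ^ (b + 1) ≤ 3 ^ d := Nat.pow_le_pow_right (by norm_num) hlt
      rw [pow_succ] at this; omega
    · exact heq
    · have : 3 ^ (d + 1) ≤ 3 ^ b := Nat.pow_le_pow_right (by norm_num) hlt
      rw [pow_succ] at this; omega
  subst hbd
  exact ⟨Nat.pow_right_injective (le_refl _ |>.trans (by norm_num : 2 ≤ 3)) (by simpa using h), rfl⟩

lemma pow3_sidon {j k j' k' : ℕ} (h : (3 : ℤ) ^ j - 3 ^ k = 3 ^ j' - 3 ^ k') (h0 : (3 : ℤ) ^ j - 3 ^ k ≠ 0) : j = j' := by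
  have h1 : 3 ^ j + 3 ^ k' = 3 ^ j' + 3 ^ k := by zify; linarith
  have hjk : j ≠ k := fun h => h0 (by rw [h]; ring)
  rcases le_total j k' with ha | ha <;> rcases le_total j' k with hb | hb
  · exact (pow3_sidon_aux ha hb h1).1
  · exact absurd (pow3_sidon_aux ha hb (by linarith)).1 hjk
  · exact absurd (pow3_sidon_aux ha hb (by linarith)).2 hjk
  · exact (pow3_sidon_aux ha hb (by linarith)).2

lemma translates (p : ℝ) (hp : 0 < p) [Fact (1 ≤ ENNReal.ofReal p)] (g : ℕ → ℝ → ℝ) (hg : ∀ i, Measurable (g i))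
    (hsum : ∑' i, ∫⁻ x in Set.Ico (0 : ℝ) 1, ‖g i x‖ₑ ^ p ≠ ∞) :
    ∃ (f : Lp ℝ (ENNReal.ofReal p) (volume : Measure ℝ)) (lam : ℕ → ℤ)
      (F : ℕ → Lp ℝ (ENNReal.ofReal p) (volume : Measure ℝ)) (κ : ℕ → ℝ≥0∞) (M : NNReal),
      Function.Injective lam ∧
      (∀ j : ℕ, (F j : ℝ → ℝ) =ᵐ[volume] fun x => f (x - (lam j : ℝ))) ∧
      (∀ j, κ j ≤ M) ∧
      ∀ (s : Finset ℕ) (a : ℕ → ℝ), ∫⁻ x, ‖(∑ i ∈ s, a i • F i : Lp ℝ (ENNReal.ofReal p) (volume : Measure ℝ)) x‖ₑ ^ p =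
        (∫⁻ x in Set.Ico (0 : ℝ) 1, ‖∑ i ∈ s, a i * g i x‖ₑ ^ p) + ∑ i ∈ s, ‖a i‖ₑ ^ p * κ i := by
  set lam : ℕ → ℤ := fun i => 3 ^ i with hlam
  have hinj : Function.Injective lam := fun i j h => by
    have : 3 ^ i = 3 ^ j := by zify; exact h
    exact Nat.pow_right_injective (by norm_num : 2 ≤ 3) this
  have hinj' : Function.Injective fun i => - lam i := fun i j h => hinj (neg_injective h)
  set γ : ℤ → ℝ → ℝ := Function.extend (fun i => - lam i) g 0 with hγ
  have hγ1 : ∀ i, γ (- lam i) = g i := fun i => hinj'.extend_apply g (0 : ℤ → ℝ → ℝ) i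
  have hγ0 : ∀ k, (¬ ∃ i, - lam i = k) → γ k = 0 := fun k hk => Function.extend_apply' (f := fun i => - lam i) g (0 : ℤ → ℝ → ℝ) k hk
  have hγm : ∀ k, Measurable (γ k) := by
    intro k
    by_cases hk : ∃ i, - lam i = k
    · obtain ⟨i, rfl⟩ := hk; rw [hγ1]; exact hg i
    · rw [hγ0 k hk]; exact measurable_zero
  set f0 : ℝ → ℝ := fun x => γ ⌊x⌋ (Int.fract x) with hf0
  have hf0m : Measurable f0 := by
    have h1 : Measurable fun z : ℤ × ℝ => γ z.1 z.2 := measurable_from_prod_countable_right hγm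
    exact h1.comp (Int.measurable_floor.prodMk measurable_fract)
  have hpt : ∀ x, ‖f0 x‖ₑ ^ p ≤ ∑' i, (Set.Ico (0 : ℝ) 1).indicator (fun x => ‖g i x‖ₑ ^ p) (x + lam i) := by
    intro x
    by_cases hk : ∃ i, - lam i = ⌊x⌋
    · obtain ⟨i, hi⟩ := hk
      have hx : x + lam i = Int.fract x := by
        have : (lam i : ℝ) = - (⌊x⌋ : ℝ) := by rw [← hi]; push_cast; ring
        rw [this, ← Int.self_sub_floor]; ring
      refine le_trans (le_of_eq ?_) (ENNReal.le_tsum i)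
      have hfr : Int.fract x ∈ Set.Ico (0 : ℝ) 1 := ⟨Int.fract_nonneg x, Int.fract_lt_one x⟩
      rw [hx, Set.indicator_of_mem hfr, hf0]
      simp only
      rw [← hi, hγ1]
    · have : f0 x = 0 := by simp only [hf0]; rw [hγ0 _ hk]; rfl
      rw [this]; simp [hp]
  have hfin : ∫⁻ x, ‖f0 x‖ₑ ^ p ≠ ∞ := by
    refine ne_top_of_le_ne_top hsum ?_
    refine (lintegral_mono hpt).trans (le_of_eq ?_)
    rw [lintegral_tsum]
    · congr 1; funext i
      rw [lintegral_add_right_eq_self (fun x => (Set.Ico (0 : ℝ) 1).indicator (fun x => ‖g i x‖ₑ ^ p) x),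
        lintegral_indicator measurableSet_Ico]
    · intro i
      exact ((((hg i).enorm.pow_const p).indicator measurableSet_Ico).comp (measurable_add_const _)).aemeasurable
  have hP0 : ENNReal.ofReal p ≠ 0 := by simpa using hp
  have hPt : ENNReal.ofReal p ≠ ∞ := ENNReal.ofReal_ne_top
  have hPr : (ENNReal.ofReal p).toReal = p := ENNReal.toReal_ofReal hp.le
  have hmem : MemLp f0 (ENNReal.ofReal p) volume := by
    refine ⟨hf0m.aestronglyMeasurable, ?_⟩
    rw [eLpNorm_lt_top_iff_lintegral_rpow_enorm_lt_top hP0 hPt, hPr]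
    exact hfin.lt_top
  have hmemj : ∀ j, MemLp (fun x => f0 (x - (lam j : ℝ))) (ENNReal.ofReal p) volume := fun j =>
    hmem.comp_measurePreserving (measurePreserving_sub_right volume (lam j : ℝ))
  set κ : ℕ → ℝ≥0∞ := fun j => ∫⁻ x in (Set.Ico (0 : ℝ) 1)ᶜ, ‖f0 (x - (lam j : ℝ))‖ₑ ^ p with hκ
  refine ⟨hmem.toLp, lam, fun j => (hmemj j).toLp, κ, (∫⁻ x, ‖f0 x‖ₑ ^ p).toNNReal, hinj, ?_, ?_, ?_⟩
  · intro j
    refine (hmemj j).coeFn_toLp.trans ?_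
    have := (measurePreserving_sub_right volume (lam j : ℝ)).quasiMeasurePreserving.ae_eq_comp hmem.coeFn_toLp
    exact this.symm
  · intro j
    rw [ENNReal.coe_toNNReal hfin]
    calc κ j ≤ ∫⁻ x, ‖f0 (x - (lam j : ℝ))‖ₑ ^ p := setLIntegral_le_lintegral _ _
      _ = _ := lintegral_sub_right_eq_self (fun x => ‖f0 x‖ₑ ^ p) _
  · intro s a
    have hae : (∑ i ∈ s, a i • (hmemj i).toLp : Lp ℝ (ENNReal.ofReal p) (volume : Measure ℝ)) =ᵐ[volume]
        fun x => ∑ i ∈ s, a i * f0 (x - (lam i : ℝ)) := by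
      have h1 : ∀ i ∈ s, (a i • (hmemj i).toLp : Lp ℝ (ENNReal.ofReal p) (volume : Measure ℝ)) =ᵐ[volume]
          fun x => a i * f0 (x - (lam i : ℝ)) := by
        intro i _
        filter_upwards [Lp.coeFn_smul (a i) (hmemj i).toLp, (hmemj i).coeFn_toLp] with x h1 h2
        rw [h1, Pi.smul_apply, h2, smul_eq_mul]
      have h2 := Lp.coeFn_finsetSum s (fun i => (a i • (hmemj i).toLp : Lp ℝ (ENNReal.ofReal p) (volume : Measure ℝ)))
      have h3 : ∀ᵐ x, ∀ i ∈ s, (a i • (hmemj i).toLp : Lp ℝ (ENNReal.ofReal p) (volume : Measure ℝ)) x =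
          a i * f0 (x - (lam i : ℝ)) := (ae_ball_iff s.countable_toSet).2 h1
      filter_upwards [h2, h3] with x h2 h3
      rw [h2, Finset.sum_apply]
      exact Finset.sum_congr rfl h3
    have h1 : ∫⁻ x, ‖(∑ i ∈ s, a i • (hmemj i).toLp : Lp ℝ (ENNReal.ofReal p) (volume : Measure ℝ)) x‖ₑ ^ p =
        ∫⁻ x, ‖∑ i ∈ s, a i * f0 (x - (lam i : ℝ))‖ₑ ^ p :=
      lintegral_congr_ae (hae.mono fun x hx => by simp only [hx])
    rw [h1, ← lintegral_add_compl _ (measurableSet_Ico (a := (0 : ℝ)) (b := 1))]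
    congr 1
    · refine setLIntegral_congr_fun measurableSet_Ico fun x hx => ?_
      congr 2
      refine Finset.sum_congr rfl fun i _ => ?_
      have hfl : ⌊x⌋ = 0 := Int.floor_eq_zero_iff.2 hx
      have hfr : Int.fract x = x := Int.fract_eq_self.2 hx
      simp only [hf0]
      rw [Int.floor_sub_intCast, Int.fract_sub_intCast, hfl, hfr, zero_sub, hγ1]
    · have hpt2 : ∀ x ∈ (Set.Ico (0 : ℝ) 1)ᶜ, ‖∑ i ∈ s, a i * f0 (x - (lam i : ℝ))‖ₑ ^ p =
          ∑ i ∈ s, ‖a i‖ₑ ^ p * ‖f0 (x - (lam i : ℝ))‖ₑ ^ p := by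
        intro x hx
        have hx0 : ⌊x⌋ ≠ 0 := fun h => hx (by rwa [Int.floor_eq_zero_iff] at h)
        have hex : ∀ j, f0 (x - (lam j : ℝ)) ≠ 0 → ∃ k, ⌊x⌋ = lam j - lam k := by
          intro j hj
          by_contra hcon
          apply hj
          simp only [hf0]
          rw [hγ0 ⌊x - (lam j : ℝ)⌋]
          · rfl
          · rintro ⟨k, hk⟩
            rw [Int.floor_sub_intCast] at hk
            exact hcon ⟨k, by omega⟩
        by_cases hall : ∀ i ∈ s, f0 (x - (lam i : ℝ)) = 0
        · rw [Finset.sum_eq_zero fun i hi => by rw [hall i hi, mul_zero],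
            Finset.sum_eq_zero fun i hi => by rw [hall i hi]; simp [hp]]
          simp [hp]
        · push Not at hall
          obtain ⟨j, hj, hne⟩ := hall
          have huniq : ∀ i ∈ s, i ≠ j → f0 (x - (lam i : ℝ)) = 0 := by
            intro i _ hij
            by_contra hc
            obtain ⟨k, hk⟩ := hex j hne
            obtain ⟨k', hk'⟩ := hex i hc
            exact hij (pow3_sidon (j := i) (k := k') (j' := j) (k' := k) (hk'.symm.trans hk) (by
              rw [show (3 : ℤ) ^ i - 3 ^ k' = ⌊x⌋ from hk'.symm]; exact hx0))
          rw [Finset.sum_eq_single_of_mem j hj fun i hi hij => by rw [huniq i hi hij, mul_zero],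
            Finset.sum_eq_single_of_mem j hj fun i hi hij => by rw [huniq i hi hij]; simp [hp]]
          rw [enorm_mul, ENNReal.mul_rpow_of_nonneg _ _ hp.le]
      rw [setLIntegral_congr_fun measurableSet_Ico.compl hpt2, lintegral_finsetSum]
      · refine Finset.sum_congr rfl fun i _ => ?_
        rw [lintegral_const_mul']
        exact ENNReal.rpow_ne_top_of_nonneg hp.le enorm_ne_top
      · intro i _
        exact (((hf0m.comp (measurable_sub_const _)).enorm.pow_const p).const_mul _)

lemma exists_psi {Y : Type*} [Nonempty Y] [MeasurableSpace Y] [StandardBorelSpace Y] (ν : Measure Y) [IsProbabilityMeasure ν] :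
    ∃ ψ : ℝ → Y, Measurable ψ ∧ Measure.map ψ (volume.restrict (Set.Ico (0 : ℝ) 1)) = ν := by
  obtain ⟨f, hf, hν⟩ := Measure.exists_measurable_map_eq ν
  have hpm : Measurable (Set.projIcc (0 : ℝ) 1 zero_le_one) := continuous_projIcc.measurable
  refine ⟨f ∘ Set.projIcc (0 : ℝ) 1 zero_le_one, hf.comp hpm, ?_⟩
  rw [← hν, restrict_Ico_eq_restrict_Icc]
  have h := (measurePreserving_subtype_coe (μa := (volume : Measure ℝ)) (measurableSet_Icc (a := (0 : ℝ)) (b := 1))).map_eq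
  rw [← h]
  refine (Measure.map_map (hf.comp hpm) measurable_subtype_coe).trans ?_
  congr 1
  funext y
  simp only [Function.comp_apply]
  rw [Set.projIcc_val]

lemma rd_enorm (i ω) : ‖rd i ω‖ₑ = 1 := by unfold rd; split_ifs <;> simp

lemma translates_sq (p : ℝ) (hp : 2 < p) [Fact (1 ≤ ENNReal.ofReal p)] (μ : Measure ℝ) [IsProbabilityMeasure μ]
    (h : ℕ → ℝ → ℝ) (hm : ∀ i, Measurable (h i)) (hsum : ∑' i, ∫⁻ x, ‖h i x‖ₑ ^ p ∂μ ≠ ∞) :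
    ∃ (f : Lp ℝ (ENNReal.ofReal p) (volume : Measure ℝ)) (lam : ℕ → ℤ)
      (F : ℕ → Lp ℝ (ENNReal.ofReal p) (volume : Measure ℝ)) (κ : ℕ → ℝ≥0∞) (M K : NNReal),
      Function.Injective lam ∧
      (∀ j : ℕ, (F j : ℝ → ℝ) =ᵐ[volume] fun x => f (x - (lam j : ℝ))) ∧
      (∀ j, κ j ≤ M) ∧
      ∀ (s : Finset ℕ) (a : ℕ → ℝ),
        (∫⁻ x, ENNReal.ofReal (∑ i ∈ s, (a i * h i x) ^ 2) ^ (p / 2) ∂μ) + ∑ i ∈ s, ‖a i‖ₑ ^ p * κ i ≤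
          ∫⁻ x, ‖(∑ i ∈ s, a i • F i : Lp ℝ (ENNReal.ofReal p) (volume : Measure ℝ)) x‖ₑ ^ p ∧
        ∫⁻ x, ‖(∑ i ∈ s, a i • F i : Lp ℝ (ENNReal.ofReal p) (volume : Measure ℝ)) x‖ₑ ^ p ≤
          K * ((∫⁻ x, ENNReal.ofReal (∑ i ∈ s, (a i * h i x) ^ 2) ^ (p / 2) ∂μ) + ∑ i ∈ s, ‖a i‖ₑ ^ p * κ i) := by
  obtain ⟨ψ, hψ, hmap⟩ := exists_psi (μ.prod coinM)
  obtain ⟨K, hK⟩ := rd_khintchine p hp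
  set g : ℕ → ℝ → ℝ := fun i x => h i (ψ x).1 * rd i (ψ x).2 with hg
  have hhr : ∀ i, Measurable fun z : ℝ × (ℕ → Bool) => h i z.1 * rd i z.2 := fun i =>
    ((hm i).comp measurable_fst).mul ((rd_meas i).comp measurable_snd)
  have htr : ∀ (G : ℝ × (ℕ → Bool) → ℝ≥0∞), Measurable G → ∫⁻ x in Set.Ico (0 : ℝ) 1, G (ψ x) =
      ∫⁻ x, ∫⁻ ω, G (x, ω) ∂coinM ∂μ := by
    intro G hG
    rw [← lintegral_prod _ hG.aemeasurable, ← hmap, lintegral_map hG hψ]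
  have hgm : ∀ i, Measurable (g i) := fun i => (hhr i).comp hψ
  have hgs : ∑' i, ∫⁻ x in Set.Ico (0 : ℝ) 1, ‖g i x‖ₑ ^ p ≠ ∞ := by
    convert hsum using 3 with i
    rw [htr (fun z => ‖h i z.1 * rd i z.2‖ₑ ^ p) ((hhr i).enorm.pow_const p)]
    refine lintegral_congr fun x => ?_
    simp [enorm_mul, rd_enorm]
  obtain ⟨f, lam, F, κ, M, h1, h2, h3, h4⟩ := translates p (by linarith) g hgm hgs
  refine ⟨f, lam, F, κ, M, K + 1, h1, h2, h3, fun s a => ?_⟩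
  rw [h4 s a]
  have hGm : Measurable fun z : ℝ × (ℕ → Bool) => ‖∑ i ∈ s, (a i * h i z.1) * rd i z.2‖ₑ ^ p := by
    refine (Measurable.enorm (Finset.measurable_sum _ fun i _ => ?_)).pow_const _
    exact (((hm i).comp measurable_fst).const_mul _).mul ((rd_meas i).comp measurable_snd)
  have h5 : ∫⁻ x in Set.Ico (0 : ℝ) 1, ‖∑ i ∈ s, a i * g i x‖ₑ ^ p =
      ∫⁻ x, ∫⁻ ω, ‖∑ i ∈ s, (a i * h i x) * rd i ω‖ₑ ^ p ∂coinM ∂μ := by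
    rw [← htr _ hGm]
    simp only [hg, mul_assoc]
  rw [h5]
  constructor
  · gcongr with x
    exact (hK _ _).1
  · rw [mul_add]
    gcongr
    · rw [← lintegral_const_mul' _ _ ENNReal.coe_ne_top]
      refine lintegral_mono fun x => (hK _ _).2.trans ?_
      gcongr
      exact le_self_add
    · push_cast
      rw [add_mul, one_mul]; exact le_add_self

lemma exists_blocks (N : ℕ → ℕ) (hN : ∀ n, 1 ≤ N n) : ∃ (blk : ℕ → ℕ) (S : ℕ → Finset ℕ),
    (∀ n i, i ∈ S n ↔ blk i = n) ∧ (∀ n, (S n).card = N n) ∧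
    ∀ u : ℕ → ℝ≥0∞, ∑' i, u (blk i) = ∑' n, (N n : ℝ≥0∞) * u n := by
  have hinf : Infinite (Σ n, Fin (N n)) :=
    Infinite.of_injective (fun n => ⟨n, ⟨0, hN n⟩⟩) fun a b hab => congrArg Sigma.fst hab
  obtain ⟨hden⟩ := nonempty_denumerable (Σ n, Fin (N n))
  set e := (Denumerable.eqv (Σ n, Fin (N n))).symm with he
  have hi : ∀ n, Function.Injective (fun k : Fin (N n) => e.symm ⟨n, k⟩) := fun n k k' hk => by simpa using hk
  refine ⟨fun i => (e i).1, fun n => (Finset.univ : Finset (Fin (N n))).map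
    ⟨fun k => e.symm ⟨n, k⟩, hi n⟩, ?_, ?_, ?_⟩
  · intro n i
    simp only [Finset.mem_map, Finset.mem_univ, true_and, Function.Embedding.coeFn_mk]
    constructor
    · rintro ⟨k, rfl⟩; simp
    · rintro rfl; exact ⟨(e i).2, by simp⟩
  · intro n; simp
  · intro u
    rw [e.tsum_eq (fun x => u x.1), ENNReal.tsum_sigma']
    congr 1; funext n
    simp

lemma exists_params (p : ℝ) (hp : 4 < p) (η : ℝ) (hη : 0 < η) (θ : ℝ) (hθ : 0 < θ) :
    ∃ (N : ℕ) (c w : ℝ), 1 ≤ N ∧ 0 < c ∧ 0 < w ∧ N * c ^ p ≤ θ ∧ N * w ^ p ≤ θ * η ∧ N * (w * c) ^ 2 = 1 := by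
  have ht : Filter.Tendsto (fun N : ℕ => (N : ℝ) ^ (p / 2 - 2)) Filter.atTop Filter.atTop :=
    (tendsto_rpow_atTop (by linarith)).comp tendsto_natCast_atTop_atTop
  obtain ⟨N, hN1, hN⟩ := ((Filter.eventually_ge_atTop 1).and (ht.eventually_ge_atTop ((θ ^ 2 * η)⁻¹))).exists
  have hN0 : (0 : ℝ) < N := by exact_mod_cast hN1
  have hp0 : 0 < p := by linarith
  set c : ℝ := (θ / N) ^ (1 / p) with hc
  have hc0 : 0 < c := by positivity
  have hcp : c ^ p = θ / N := by
    rw [hc, ← Real.rpow_mul (by positivity), one_div_mul_cancel hp0.ne', Real.rpow_one]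
  refine ⟨N, c, (Real.sqrt N * c)⁻¹, hN1, hc0, by positivity, ?_, ?_, ?_⟩
  · rw [hcp]; field_simp; exact le_rfl
  · have h1 : (Real.sqrt N * c)⁻¹ ^ p = ((N : ℝ) ^ (p / 2))⁻¹ * (N / θ) := by
      rw [Real.inv_rpow (by positivity), Real.mul_rpow (by positivity) hc0.le, hcp, mul_inv, inv_div,
        Real.sqrt_eq_rpow, ← Real.rpow_mul hN0.le]
      congr 3; ring
    have h2 : (N : ℝ) ^ (p / 2) = (N : ℝ) ^ (p / 2 - 2) * N ^ 2 := by
      rw [← Real.rpow_natCast, ← Real.rpow_add hN0]; congr 1; push_cast; ring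
    rw [h1, h2]
    have h3 : 1 ≤ (N : ℝ) ^ (p / 2 - 2) * (θ ^ 2 * η) := by
      rw [inv_le_iff_one_le_mul₀ (by positivity)] at hN; linarith
    have hX : 0 < (N : ℝ) ^ (p / 2 - 2) := by positivity
    calc (N : ℝ) * (((N : ℝ) ^ (p / 2 - 2) * N ^ 2)⁻¹ * (N / θ)) = 1 / ((N : ℝ) ^ (p / 2 - 2) * θ) := by
          field_simp
      _ ≤ θ * η := by
          rw [div_le_iff₀ (by positivity)]
          nlinarith
  · have : (Real.sqrt N * c)⁻¹ * c = (Real.sqrt N)⁻¹ := by field_simp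
    rw [this, inv_pow, Real.sq_sqrt hN0.le]; field_simp

lemma norm_le_of_lint (p : ℝ) (hp : 1 ≤ p) [Fact (1 ≤ ENNReal.ofReal p)] {X Y : Type*} [MeasurableSpace X] [MeasurableSpace Y]
    {μ : Measure X} {ν : Measure Y} (u : Lp ℝ (ENNReal.ofReal p) μ) (v : Lp ℝ (ENNReal.ofReal p) ν) (K : NNReal)
    (h : ∫⁻ x, ‖u x‖ₑ ^ p ∂μ ≤ K * ∫⁻ y, ‖v y‖ₑ ^ p ∂ν) : ‖u‖ ≤ (K : ℝ) ^ (1 / p) * ‖v‖ := by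
  have hp0 : 0 < p := by linarith
  have hP0 : ENNReal.ofReal p ≠ 0 := by simpa using hp0
  have hPt : ENNReal.ofReal p ≠ ∞ := ENNReal.ofReal_ne_top
  have hPr : (ENNReal.ofReal p).toReal = p := ENNReal.toReal_ofReal hp0.le
  rw [Lp.norm_def, Lp.norm_def]
  have h1 : eLpNorm u (ENNReal.ofReal p) μ ≤ ((K : ℝ≥0∞) ^ (1 / p)) * eLpNorm v (ENNReal.ofReal p) ν := by
    rw [eLpNorm_eq_lintegral_rpow_enorm_toReal hP0 hPt, eLpNorm_eq_lintegral_rpow_enorm_toReal hP0 hPt, hPr,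
      ← ENNReal.mul_rpow_of_nonneg _ _ (by positivity)]
    exact ENNReal.rpow_le_rpow h (by positivity)
  have h2 := ENNReal.toReal_mono (ENNReal.mul_ne_top (ENNReal.rpow_ne_top_of_nonneg (by positivity) ENNReal.coe_ne_top) (Lp.eLpNorm_ne_top v)) h1
  rw [ENNReal.toReal_mul, ← ENNReal.toReal_rpow] at h2
  exact h2

lemma ofReal_sq_rpow (p : ℝ) (y : ℝ) : ENNReal.ofReal (y ^ 2) ^ (p / 2) = ‖y‖ₑ ^ p := by
  rw [← sq_abs, ENNReal.ofReal_pow (abs_nonneg y), ← Real.enorm_eq_ofReal_abs, ← ENNReal.rpow_natCast, ← ENNReal.rpow_mul]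
  congr 1; push_cast; ring

lemma main_blocks (p : ℝ) (hp : 4 < p) [Fact (1 ≤ ENNReal.ofReal p)] (q : ℕ → ℝ) (hq : Function.Injective q)
    (μ : Measure ℝ) [IsProbabilityMeasure μ] [μ.IsOpenPosMeasure] :
    ∃ (f : Lp ℝ (ENNReal.ofReal p) (volume : Measure ℝ)) (lam : ℕ → ℤ)
      (F b : ℕ → Lp ℝ (ENNReal.ofReal p) (volume : Measure ℝ)) (K : NNReal),
      Function.Injective lam ∧
      (∀ j : ℕ, (F j : ℝ → ℝ) =ᵐ[volume] fun x => f (x - (lam j : ℝ))) ∧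
      (∀ j, F j ≠ 0) ∧
      (∀ (a : ℕ → ℝ) (s : Finset ℕ) (sgn : ℕ → ℝ), (∀ i, sgn i = 1 ∨ sgn i = -1) →
        ∫⁻ x, ‖(∑ i ∈ s, (sgn i * a i) • F i : Lp ℝ (ENNReal.ofReal p) (volume : Measure ℝ)) x‖ₑ ^ p ≤
          K * ∫⁻ x, ‖(∑ i ∈ s, a i • F i : Lp ℝ (ENNReal.ofReal p) (volume : Measure ℝ)) x‖ₑ ^ p) ∧
      (∀ (a : ℕ → ℝ) (m n : ℕ), m ≤ n →
        ∫⁻ x, ‖(∑ i ∈ Finset.range m, a i • F i : Lp ℝ (ENNReal.ofReal p) (volume : Measure ℝ)) x‖ₑ ^ p ≤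
          K * ∫⁻ x, ‖(∑ i ∈ Finset.range n, a i • F i : Lp ℝ (ENNReal.ofReal p) (volume : Measure ℝ)) x‖ₑ ^ p) ∧
      (∀ n, b n ∈ Submodule.span ℝ (Set.range F)) ∧
      (∀ (t : ℕ → ℝ) (m : ℕ),
        ∫⁻ x, ‖(∑ n ∈ Finset.range m, t n • b n : Lp ℝ (ENNReal.ofReal p) (volume : Measure ℝ)) x‖ₑ ^ p ≤
          K * ∫⁻ x, ‖∑ n ∈ Finset.range m, t n * hH q μ n x‖ₑ ^ p ∂μ ∧
        ∫⁻ x, ‖∑ n ∈ Finset.range m, t n * hH q μ n x‖ₑ ^ p ∂μ ≤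
          K * ∫⁻ x, ‖(∑ n ∈ Finset.range m, t n • b n : Lp ℝ (ENNReal.ofReal p) (volume : Measure ℝ)) x‖ₑ ^ p) := by
  have hp0 : 0 < p := by linarith
  have hHle : ∀ n, ∫⁻ x, ‖hH q μ n x‖ₑ ^ p ∂μ ≤ 1 := by
    intro n
    calc _ ≤ ∫⁻ x, 1 ∂μ := lintegral_mono fun x => by
          refine ENNReal.rpow_le_one ?_ hp0.le
          rw [Real.enorm_eq_ofReal_abs]
          exact ENNReal.ofReal_le_one.2 (hH_le q μ n x)
      _ = 1 := by simp
  have hHt : ∀ n, ∫⁻ x, ‖hH q μ n x‖ₑ ^ p ∂μ ≠ ∞ := fun n => ne_top_of_le_ne_top ENNReal.one_ne_top (hHle n)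
  have hη : ∀ n, 0 < (∫⁻ x, ‖hH q μ n x‖ₑ ^ p ∂μ).toReal := fun n =>
    ENNReal.toReal_pos (hH_pos q hq μ p hp0 n).ne' (hHt n)
  choose N c w hN hc hw h1 h2 h3 using fun n => exists_params p hp _ (hη n) ((1 / 2 : ℝ) ^ n) (by positivity)
  obtain ⟨blk, S, hS, hcard, htsum⟩ := exists_blocks N hN
  have hgeo : ∑' n : ℕ, ENNReal.ofReal ((1 / 2 : ℝ) ^ n) = 2 := by
    rw [← ENNReal.ofReal_tsum_of_nonneg (fun n => by positivity) summable_geometric_two, tsum_geometric_two]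
    norm_num
  have hec : ∀ n, ‖c n‖ₑ ^ p = ENNReal.ofReal (c n ^ p) := fun n => by
    rw [Real.enorm_of_nonneg (hc n).le, ENNReal.ofReal_rpow_of_pos (hc n)]
  have hew : ∀ n, ‖w n‖ₑ ^ p = ENNReal.ofReal (w n ^ p) := fun n => by
    rw [Real.enorm_of_nonneg (hw n).le, ENNReal.ofReal_rpow_of_pos (hw n)]
  set h : ℕ → ℝ → ℝ := fun i x => c (blk i) * hH q μ (blk i) x with hh
  have hm : ∀ i, Measurable (h i) := fun i => (hH_meas q μ _).const_mul _
  have hinteq : ∀ i, ∫⁻ x, ‖h i x‖ₑ ^ p ∂μ = ‖c (blk i)‖ₑ ^ p * ∫⁻ x, ‖hH q μ (blk i) x‖ₑ ^ p ∂μ := by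
    intro i
    rw [← lintegral_const_mul' _ _ (ENNReal.rpow_ne_top_of_nonneg hp0.le enorm_ne_top)]
    refine lintegral_congr fun x => ?_
    rw [hh, enorm_mul, ENNReal.mul_rpow_of_nonneg _ _ hp0.le]
  have hsum : ∑' i, ∫⁻ x, ‖h i x‖ₑ ^ p ∂μ ≠ ∞ := by
    refine ne_top_of_le_ne_top (b := 2) (by norm_num) ?_
    calc ∑' i, ∫⁻ x, ‖h i x‖ₑ ^ p ∂μ ≤ ∑' i, ‖c (blk i)‖ₑ ^ p := ENNReal.tsum_le_tsum fun i => by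
          rw [hinteq]; exact mul_le_of_le_one_right' (hHle _)
      _ = ∑' n, (N n : ℝ≥0∞) * ‖c n‖ₑ ^ p := htsum fun n => ‖c n‖ₑ ^ p
      _ ≤ ∑' n : ℕ, ENNReal.ofReal ((1 / 2 : ℝ) ^ n) := ENNReal.tsum_le_tsum fun n => by
          rw [hec, ← ENNReal.ofReal_natCast, ← ENNReal.ofReal_mul (by positivity)]
          exact ENNReal.ofReal_le_ofReal (h1 n)
      _ = 2 := hgeo
  obtain ⟨f, lam, F, κ, M, K, hinj, htr, hκ, hQ⟩ := translates_sq p (by linarith) μ h hm hsum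
  obtain ⟨L, hL⟩ := haar_sq p hp q μ
  set b : ℕ → Lp ℝ (ENNReal.ofReal p) (volume : Measure ℝ) := fun n => ∑ i ∈ S n, w n • F i with hb
  refine ⟨f, lam, F, b, K + K * (1 + 2 * M) * L + L, hinj, htr, ?_, ?_, ?_, ?_, ?_⟩
  · intro j hj
    have := (hQ {j} (fun _ => 1)).1
    simp only [Finset.sum_singleton, one_smul, hj, one_mul, ofReal_sq_rpow] at this
    have h0 : ∫⁻ x, ‖(0 : Lp ℝ (ENNReal.ofReal p) (volume : Measure ℝ)) x‖ₑ ^ p = 0 := by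
      rw [lintegral_eq_zero_iff' ((Lp.aestronglyMeasurable _).enorm.pow_const p)]
      filter_upwards [Lp.coeFn_zero ℝ (ENNReal.ofReal p) (volume : Measure ℝ)] with x hx
      simp [hp0]
    rw [h0, hinteq] at this
    have h4 := (le_self_add.trans this)
    rw [nonpos_iff_eq_zero, mul_eq_zero] at h4
    rcases h4 with h4 | h4
    · rw [hec] at h4
      have := hc (blk j)
      rw [ENNReal.ofReal_eq_zero] at h4
      have : 0 < c (blk j) ^ p := by positivity
      linarith
    · exact (hH_pos q hq μ p hp0 (blk j)).ne' h4
  · intro a s sgn hsgn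
    have e1 : ∀ i, ∀ y : ℝ, (sgn i * a i * y) ^ 2 = (a i * y) ^ 2 := fun i y => by
      rcases hsgn i with h | h <;> rw [h] <;> ring
    have e2 : ∀ i, ‖sgn i * a i‖ₑ = ‖a i‖ₑ := fun i => by
      rcases hsgn i with h | h <;> rw [h] <;> simp
    have := (hQ s (fun i => sgn i * a i)).2
    simp only [e1, e2] at this
    refine this.trans ?_
    refine mul_le_mul' ?_ (hQ s a).1
    push_cast; rw [add_assoc]; exact le_self_add
  · intro a m n hmn
    refine (hQ (Finset.range m) a).2.trans ?_
    refine (mul_le_mul' ?_ (le_trans ?_ (hQ (Finset.range n) a).1))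
    · push_cast; rw [add_assoc]; exact le_self_add
    · have hsub : Finset.range m ⊆ Finset.range n := Finset.range_mono hmn
      refine add_le_add (lintegral_mono fun x => ?_) (Finset.sum_le_sum_of_subset hsub)
      refine ENNReal.rpow_le_rpow (ENNReal.ofReal_le_ofReal ?_) (by positivity)
      exact Finset.sum_le_sum_of_subset_of_nonneg hsub fun i _ _ => sq_nonneg _
  · intro n
    exact Submodule.sum_mem _ fun i _ => Submodule.smul_mem _ _ (Submodule.subset_span ⟨i, rfl⟩)
  · intro t m
    have hdj : Set.PairwiseDisjoint (↑(Finset.range m)) S := by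
      intro n _ n' _ hnn
      rw [Function.onFun, Finset.disjoint_left]
      intro i hi hi'
      exact hnn (((hS n i).1 hi).symm.trans ((hS n' i).1 hi'))
    set s := (Finset.range m).biUnion S with hs
    set a : ℕ → ℝ := fun i => t (blk i) * w (blk i) with ha
    set A := ∫⁻ x, ENNReal.ofReal (∑ i ∈ Finset.range m, (t i * hH q μ i x) ^ 2) ^ (p / 2) ∂μ with hA
    have hF : ∑ n ∈ Finset.range m, t n • b n = ∑ i ∈ s, a i • F i := by
      rw [hs, Finset.sum_biUnion hdj]
      refine Finset.sum_congr rfl fun n _ => ?_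
      rw [hb, Finset.smul_sum]
      refine Finset.sum_congr rfl fun i hi => ?_
      rw [ha]; simp only [(hS n i).1 hi, smul_smul]
    have hA2 : ∫⁻ x, ENNReal.ofReal (∑ i ∈ s, (a i * h i x) ^ 2) ^ (p / 2) ∂μ = A := by
      refine lintegral_congr fun x => ?_
      congr 2
      rw [hs, Finset.sum_biUnion hdj]
      refine Finset.sum_congr rfl fun n _ => ?_
      have : ∀ i ∈ S n, (a i * h i x) ^ 2 = (w n * c n) ^ 2 * (t n * hH q μ n x) ^ 2 := fun i hi => by
        rw [ha, hh]; simp only [(hS n i).1 hi]; ring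
      rw [Finset.sum_congr rfl this, Finset.sum_const, hcard, nsmul_eq_mul, ← mul_assoc, h3, one_mul]
    have hR : ∑ i ∈ s, ‖a i‖ₑ ^ p * κ i ≤ 2 * M * A := by
      have hone : ∀ n ∈ Finset.range m, ∑ i ∈ S n, ‖a i‖ₑ ^ p * κ i ≤ ENNReal.ofReal ((1 / 2 : ℝ) ^ n) * (M * A) := by
        intro n hn
        have hAn : ‖t n‖ₑ ^ p * ∫⁻ x, ‖hH q μ n x‖ₑ ^ p ∂μ ≤ A := by
          rw [← lintegral_const_mul' _ _ (ENNReal.rpow_ne_top_of_nonneg hp0.le enorm_ne_top)]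
          refine lintegral_mono fun x => ?_
          rw [← ENNReal.mul_rpow_of_nonneg _ _ hp0.le, ← enorm_mul, ← ofReal_sq_rpow]
          refine ENNReal.rpow_le_rpow (ENNReal.ofReal_le_ofReal ?_) (by positivity)
          exact Finset.single_le_sum (f := fun i => (t i * hH q μ i x) ^ 2) (fun i _ => sq_nonneg _) hn
        calc ∑ i ∈ S n, ‖a i‖ₑ ^ p * κ i ≤ ∑ i ∈ S n, ‖t n‖ₑ ^ p * ‖w n‖ₑ ^ p * M := Finset.sum_le_sum fun i hi => by
              rw [ha]; simp only [(hS n i).1 hi]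
              rw [enorm_mul, ENNReal.mul_rpow_of_nonneg _ _ hp0.le]
              gcongr
              exact hκ i
          _ = (N n * ‖w n‖ₑ ^ p) * (‖t n‖ₑ ^ p * M) := by
              rw [Finset.sum_const, hcard, nsmul_eq_mul]; ring
          _ ≤ (ENNReal.ofReal ((1 / 2 : ℝ) ^ n) * ∫⁻ x, ‖hH q μ n x‖ₑ ^ p ∂μ) * (‖t n‖ₑ ^ p * M) := by
              refine mul_le_mul' ?_ le_rfl
              rw [hew, ← ENNReal.ofReal_natCast, ← ENNReal.ofReal_mul (by positivity)]
              refine (ENNReal.ofReal_le_ofReal (h2 n)).trans ?_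
              rw [ENNReal.ofReal_mul (by positivity), ENNReal.ofReal_toReal (hHt n)]
          _ = ENNReal.ofReal ((1 / 2 : ℝ) ^ n) * (M * (‖t n‖ₑ ^ p * ∫⁻ x, ‖hH q μ n x‖ₑ ^ p ∂μ)) := by ring
          _ ≤ _ := by gcongr
      rw [hs, Finset.sum_biUnion hdj]
      refine (Finset.sum_le_sum hone).trans ?_
      rw [← Finset.sum_mul, mul_assoc]
      gcongr
      rw [← hgeo]
      exact ENNReal.sum_le_tsum _
    obtain ⟨q1, q2⟩ := hQ s a
    obtain ⟨l1, l2⟩ := hL m t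
    rw [← hF, hA2] at q1 q2
    have hcast : ((K + K * (1 + 2 * M) * L + L : NNReal) : ℝ≥0∞) = K + K * (1 + 2 * M) * L + L := by
      push_cast; rfl
    rw [hcast]
    constructor
    · calc _ ≤ K * (A + ∑ i ∈ s, ‖a i‖ₑ ^ p * κ i) := q2
        _ ≤ K * (A + 2 * M * A) := by gcongr
        _ = K * (1 + 2 * M) * A := by ring
        _ ≤ K * (1 + 2 * M) * (L * _) := by gcongr
        _ = (K * (1 + 2 * M) * L) * _ := by rw [mul_assoc _ (L : ℝ≥0∞)]
        _ ≤ _ := mul_le_mul' (le_add_self.trans le_self_add) le_rfl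
    · refine l2.trans (mul_le_mul' le_add_self (le_self_add.trans q1))

lemma gauss_lint (p : ℝ) (hp : 1 ≤ p) (g : ℝ → ℝ) :
    ∫⁻ x, ‖g x * (ProbabilityTheory.gaussianPDFReal 0 1 x) ^ (-1 / p)‖ₑ ^ p ∂(ProbabilityTheory.gaussianReal 0 1)
      = ∫⁻ x, ‖g x‖ₑ ^ p := by
  have hp0 : 0 < p := by linarith
  rw [ProbabilityTheory.gaussianReal_of_var_ne_zero 0 one_ne_zero,
    lintegral_withDensity_eq_lintegral_mul_non_measurable volume (ProbabilityTheory.measurable_gaussianPDF 0 1)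
      (ae_of_all _ fun _ => ProbabilityTheory.gaussianPDF_lt_top)]
  refine lintegral_congr fun x => ?_
  have hd := ProbabilityTheory.gaussianPDFReal_pos 0 1 x one_ne_zero
  rw [Pi.mul_apply, ProbabilityTheory.gaussianPDF_def]
  simp only
  set d := ProbabilityTheory.gaussianPDFReal 0 1 x
  rw [enorm_mul, ENNReal.mul_rpow_of_nonneg _ _ hp0.le,
    Real.enorm_eq_ofReal (Real.rpow_nonneg hd.le _), ENNReal.ofReal_rpow_of_nonneg (Real.rpow_nonneg hd.le _) hp0.le,
    ← Real.rpow_mul hd.le, div_mul_cancel₀ _ hp0.ne', mul_left_comm, ← ENNReal.ofReal_mul hd.le,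
    Real.rpow_neg_one, mul_inv_cancel₀ hd.ne', ENNReal.ofReal_one, mul_one]

lemma exists_gauss_isometry (p : ℝ) (hp : 1 ≤ p) [Fact (1 ≤ ENNReal.ofReal p)] :
    ∃ J : Lp ℝ (ENNReal.ofReal p) (volume : Measure ℝ) →ₗ[ℝ]
      Lp ℝ (ENNReal.ofReal p) (ProbabilityTheory.gaussianReal 0 1), ∀ g, ‖J g‖ = ‖g‖ := by
  have hp0 : 0 < p := by linarith
  have hP0 : ENNReal.ofReal p ≠ 0 := by simpa using hp0
  have hPt : ENNReal.ofReal p ≠ ∞ := ENNReal.ofReal_ne_top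
  have hPr : (ENNReal.ofReal p).toReal = p := ENNReal.toReal_ofReal hp0.le
  have hac := ProbabilityTheory.gaussianReal_absolutelyContinuous 0 (one_ne_zero (α := NNReal))
  have hmem : ∀ g : Lp ℝ (ENNReal.ofReal p) (volume : Measure ℝ),
      MemLp (fun x => g x * (ProbabilityTheory.gaussianPDFReal 0 1 x) ^ (-1 / p)) (ENNReal.ofReal p)
        (ProbabilityTheory.gaussianReal 0 1) := by
    intro g
    refine ⟨?_, ?_⟩
    · refine ((Lp.aestronglyMeasurable g).mono_ac hac).mul ?_
      exact ((ProbabilityTheory.measurable_gaussianPDFReal 0 1).pow_const _).aestronglyMeasurable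
    · rw [eLpNorm_lt_top_iff_lintegral_rpow_enorm_lt_top hP0 hPt, hPr, gauss_lint p hp]
      have := (eLpNorm_lt_top_iff_lintegral_rpow_enorm_lt_top hP0 hPt).1 (Lp.eLpNorm_lt_top g)
      rwa [hPr] at this
  refine ⟨{ toFun := fun g => (hmem g).toLp, map_add' := ?_, map_smul' := ?_ }, ?_⟩
  · intro g h
    rw [← MemLp.toLp_add]
    refine MemLp.toLp_congr _ _ ?_
    filter_upwards [hac.ae_le (Lp.coeFn_add g h)] with x hx
    simp only [Pi.add_apply] at hx ⊢
    rw [hx]; ring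
  · intro c g
    rw [RingHom.id_apply, ← MemLp.toLp_const_smul]
    refine MemLp.toLp_congr _ _ ?_
    filter_upwards [hac.ae_le (Lp.coeFn_smul c g)] with x hx
    simp only [Pi.smul_apply, smul_eq_mul] at hx ⊢
    rw [hx]; ring
  · intro g
    simp only [LinearMap.coe_mk, AddHom.coe_mk]
    have hinteq : ∫⁻ x, ‖(hmem g).toLp _ x‖ₑ ^ p ∂(ProbabilityTheory.gaussianReal 0 1) = ∫⁻ x, ‖g x‖ₑ ^ p := by
      rw [← gauss_lint p hp]
      exact lintegral_congr_ae ((hmem g).coeFn_toLp.mono fun x hx => by simp only [hx])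
    apply le_antisymm
    · simpa using norm_le_of_lint p hp ((hmem g).toLp) g 1 (by rw [hinteq]; simp)
    · simpa using norm_le_of_lint p hp g ((hmem g).toLp) 1 (by rw [hinteq]; simp)

lemma exists_embed (p : ℝ) (hp : 1 ≤ p) [Fact (1 ≤ ENNReal.ofReal p)] (q : ℕ → ℝ) (hq : Function.Injective q)
    (hqr : ∀ a : ℚ, ∃ n, q n = a) (μ : Measure ℝ) [IsProbabilityMeasure μ] [μ.IsOpenPosMeasure]
    (S : Submodule ℝ (Lp ℝ (ENNReal.ofReal p) (volume : Measure ℝ)))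
    (b : ℕ → Lp ℝ (ENNReal.ofReal p) (volume : Measure ℝ)) (hb : ∀ n, b n ∈ S) (K : NNReal)
    (h : ∀ (t : ℕ → ℝ) (m : ℕ),
      ∫⁻ x, ‖(∑ n ∈ Finset.range m, t n • b n : Lp ℝ (ENNReal.ofReal p) (volume : Measure ℝ)) x‖ₑ ^ p
          ≤ K * ∫⁻ x, ‖∑ n ∈ Finset.range m, t n * hH q μ n x‖ₑ ^ p ∂μ ∧
      ∫⁻ x, ‖∑ n ∈ Finset.range m, t n * hH q μ n x‖ₑ ^ p ∂μ
          ≤ K * ∫⁻ x, ‖(∑ n ∈ Finset.range m, t n • b n : Lp ℝ (ENNReal.ofReal p) (volume : Measure ℝ)) x‖ₑ ^ p) :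
    ∃ T : Lp ℝ (ENNReal.ofReal p) μ →ₗ[ℝ] Lp ℝ (ENNReal.ofReal p) (volume : Measure ℝ),
      (∀ g, T g ∈ S.topologicalClosure) ∧
      ∀ g, ‖g‖ ≤ (K : ℝ) ^ (1 / p) * ‖T g‖ ∧ ‖T g‖ ≤ (K : ℝ) ^ (1 / p) * ‖g‖ := by
  have hm : ∀ n, MemLp (hH q μ n) (ENNReal.ofReal p) μ := fun n =>
    MemLp.of_bound (hH_meas q μ n).aestronglyMeasurable 1 (ae_of_all _ fun x => hH_le q μ n x)
  let A : (ℕ →₀ ℝ) →ₗ[ℝ] Lp ℝ (ENNReal.ofReal p) μ := Finsupp.linearCombination ℝ (fun n => (hm n).toLp)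
  let B : (ℕ →₀ ℝ) →ₗ[ℝ] Lp ℝ (ENNReal.ofReal p) (volume : Measure ℝ) := Finsupp.linearCombination ℝ b
  have hdense : DenseRange A := by
    have h1 := hH_dense (P := ENNReal.ofReal p) ENNReal.ofReal_ne_top q hq hqr μ hm
    rw [← Finsupp.range_linearCombination, ← Submodule.dense_iff_topologicalClosure_eq_top] at h1
    exact h1
  have hAB : ∀ t, ‖B t‖ ≤ (K : ℝ) ^ (1 / p) * ‖A t‖ ∧ ‖A t‖ ≤ (K : ℝ) ^ (1 / p) * ‖B t‖ := by
    intro t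
    obtain ⟨m, hms⟩ := t.support.exists_nat_subset_range
    have hA : A t = ∑ n ∈ Finset.range m, t n • (hm n).toLp := by
      simp only [A, Finsupp.linearCombination_apply]
      exact Finsupp.sum_of_support_subset t hms _ (fun i _ => by simp)
    have hB : B t = ∑ n ∈ Finset.range m, t n • b n := by
      simp only [B, Finsupp.linearCombination_apply]
      exact Finsupp.sum_of_support_subset t hms _ (fun i _ => by simp)
    have hae : (A t : ℝ → ℝ) =ᵐ[μ] fun x => ∑ n ∈ Finset.range m, t n * hH q μ n x := by
      rw [hA]
      have h1 : ∀ i ∈ Finset.range m, (t i • (hm i).toLp : Lp ℝ (ENNReal.ofReal p) μ) =ᵐ[μ]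
          fun x => t i * hH q μ i x := by
        intro i _
        filter_upwards [Lp.coeFn_smul (t i) (hm i).toLp, (hm i).coeFn_toLp] with x h1 h2
        rw [h1, Pi.smul_apply, h2, smul_eq_mul]
      have h2 := Lp.coeFn_finsetSum (Finset.range m) (fun i => (t i • (hm i).toLp : Lp ℝ (ENNReal.ofReal p) μ))
      have h3 : ∀ᵐ x ∂μ, ∀ i ∈ Finset.range m, (t i • (hm i).toLp : Lp ℝ (ENNReal.ofReal p) μ) x =
          t i * hH q μ i x := (ae_ball_iff (Finset.range m).countable_toSet).2 h1
      filter_upwards [h2, h3] with x h2 h3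
      rw [h2, Finset.sum_apply]
      exact Finset.sum_congr rfl h3
    have hinteq : ∫⁻ x, ‖A t x‖ₑ ^ p ∂μ = ∫⁻ x, ‖∑ n ∈ Finset.range m, t n * hH q μ n x‖ₑ ^ p ∂μ :=
      lintegral_congr_ae (hae.mono fun x hx => by simp only [hx])
    have hh := h t m
    rw [← hinteq, ← hB] at hh
    exact ⟨norm_le_of_lint p hp _ _ K hh.1, norm_le_of_lint p hp _ _ K hh.2⟩
  have hC : ∀ t, ‖B t‖ ≤ (K : ℝ) ^ (1 / p) * ‖A t‖ := fun t => (hAB t).1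
  let T0 := B.extendOfNorm A
  have hT0 : ∀ t, T0 (A t) = B t := fun t => LinearMap.extendOfNorm_eq hdense ⟨_, hC⟩ t
  have hT0c : Continuous T0 := T0.continuous
  refine ⟨T0.toLinearMap, ?_, ?_⟩
  · intro g
    refine hdense.induction (P := fun g => T0 g ∈ S.topologicalClosure) ?_ ?_ g
    · rintro _ ⟨t, rfl⟩
      rw [hT0]
      refine S.le_topologicalClosure ?_
      simp only [B, Finsupp.linearCombination_apply]
      exact S.sum_mem fun i _ => S.smul_mem _ (hb i)
    · exact S.isClosed_topologicalClosure.preimage hT0c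
  · intro g
    refine ⟨?_, LinearMap.norm_extendOfNorm_apply_le hdense _ hC g⟩
    refine hdense.induction (P := fun g => ‖g‖ ≤ (K : ℝ) ^ (1 / p) * ‖T0 g‖) ?_ ?_ g
    · rintro _ ⟨t, rfl⟩
      rw [hT0]
      exact (hAB t).2
    · exact isClosed_le continuous_norm (continuous_const.mul hT0c.norm)

/-- Let `4 < p < ∞`.  There exist `f ∈ L_p(ℝ)` and a sequence of distinct
integer translates of `f` forming an unconditional basic sequence whose closed
linear span contains an isomorphic copy of `L_p(ℝ)`. -/
theorem exists_unconditional_translates_span_containing_Lp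
    (p : ℝ) (hp : 4 < p) [Fact (1 ≤ ENNReal.ofReal p)] :
    ∃ (f : Lp ℝ (ENNReal.ofReal p) (volume : Measure ℝ)) (lam : ℕ → ℤ)
      (F : ℕ → Lp ℝ (ENNReal.ofReal p) (volume : Measure ℝ)),
      Function.Injective lam ∧
      (∀ j : ℕ, (F j : ℝ → ℝ) =ᵐ[volume] fun x => f (x - (lam j : ℝ))) ∧
      (∀ j, F j ≠ 0) ∧
      (∃ C : ℝ, ∀ (a : ℕ → ℝ) (s : Finset ℕ) (sgn : ℕ → ℝ),
        (∀ i, sgn i = 1 ∨ sgn i = -1) →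
        ‖∑ i ∈ s, (sgn i * a i) • F i‖ ≤ C * ‖∑ i ∈ s, a i • F i‖) ∧
      (∃ K : ℝ, ∀ (a : ℕ → ℝ) (m n : ℕ), m ≤ n →
        ‖∑ i ∈ Finset.range m, a i • F i‖ ≤ K * ‖∑ i ∈ Finset.range n, a i • F i‖) ∧
      (∃ c C : ℝ, 0 < c ∧ c ≤ C ∧
        ∃ T : Lp ℝ (ENNReal.ofReal p) (volume : Measure ℝ) →ₗ[ℝ]
            Lp ℝ (ENNReal.ofReal p) (volume : Measure ℝ),
          (∀ g, T g ∈ (Submodule.span ℝ (Set.range F)).topologicalClosure) ∧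
          ∀ g, c * ‖g‖ ≤ ‖T g‖ ∧ ‖T g‖ ≤ C * ‖g‖) := by
  have hp1 : 1 ≤ p := by linarith
  let q : ℕ → ℝ := fun n => (((Denumerable.eqv ℚ).symm n : ℚ) : ℝ)
  have hq : Function.Injective q := Rat.cast_injective.comp (Denumerable.eqv ℚ).symm.injective
  have hqr : ∀ a : ℚ, ∃ n, q n = a := fun a => ⟨Denumerable.eqv ℚ a, by simp [q]⟩
  have : (ProbabilityTheory.gaussianReal 0 1).IsOpenPosMeasure :=
    (ProbabilityTheory.gaussianReal_absolutelyContinuous' 0 (one_ne_zero (α := NNReal))).isOpenPosMeasure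
  obtain ⟨f, lam, F, b, K, h1, h2, h3, h4, h5, h6, h7⟩ :=
    main_blocks p hp q hq (ProbabilityTheory.gaussianReal 0 1)
  obtain ⟨T, hT1, hT2⟩ := exists_embed p hp1 q hq hqr (ProbabilityTheory.gaussianReal 0 1) _ b h6 K h7
  obtain ⟨J, hJ⟩ := exists_gauss_isometry p hp1
  refine ⟨f, lam, F, h1, h2, h3, ⟨(K : ℝ) ^ (1 / p), fun a s sgn hs => ?_⟩,
    ⟨(K : ℝ) ^ (1 / p), fun a m n hmn => ?_⟩, ?_⟩
  · exact norm_le_of_lint p hp1 _ _ K (h4 a s sgn hs)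
  · exact norm_le_of_lint p hp1 _ _ K (h5 a m n hmn)
  · have hM : 1 ≤ max 1 ((K : ℝ) ^ (1 / p)) := le_max_left _ _
    have hM' : (K : ℝ) ^ (1 / p) ≤ max 1 ((K : ℝ) ^ (1 / p)) := le_max_right _ _
    generalize max 1 ((K : ℝ) ^ (1 / p)) = M at hM hM'
    have hM0 : 0 < M := by linarith
    refine ⟨M⁻¹, M, by positivity, (inv_le_one_of_one_le₀ hM).trans hM, T ∘ₗ J, fun g => hT1 _, fun g => ?_⟩
    have h8 := hT2 (J g)
    rw [hJ] at h8
    rw [LinearMap.comp_apply]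
    constructor
    · rw [inv_mul_le_iff₀ hM0]
      exact h8.1.trans (by gcongr)
    · exact h8.2.trans (by gcongr)
end

section
/- Let 1 < p ≤ 2, let f ∈ L_p(ℝ; ℂ), and let λ > 0. Then the closed linear span in L_p(ℝ; ℂ) of the translates {f_(λn) : n ∈ ℤ} is a proper subspace of L_p(ℝ; ℂ). -/
open MeasureTheory ENNReal

/-- Young-type estimate: `L_p * (nice) ⊆ L_q` for conjugate exponents `p ≤ q`. -/
lemma aux_young {p q : ℝ} (hpq : p.HolderConjugate q) (hle : p ≤ q)
    (F Φ : ℝ → ℝ≥0∞) (hF : Measurable F) (hΦ : Measurable Φ)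
    (S : Set ℝ) (hS : MeasurableSet S) (hSfin : volume S ≠ ⊤)
    (hsupp : ∀ x, x ∉ S → Φ x = 0)
    (hFp : ∫⁻ x, F x ^ p ≠ ⊤) (hΦq : ∫⁻ x, Φ x ^ q ≠ ⊤) :
    ∫⁻ x, (∫⁻ y, F y * Φ (x + y)) ^ q ≠ ⊤ := by
  have hp0 : 0 < p := hpq.pos
  have hq0 : 0 < q := hpq.symm.pos
  set N := ∫⁻ x, F x ^ p with hN
  set C := ∫⁻ x, Φ x ^ q with hC
  let χ : ℝ → ℝ≥0∞ := S.indicator 1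
  have hχ : Measurable χ := measurable_one.indicator hS
  have hχ1 : ∀ x, χ x ≤ 1 := fun x => Set.indicator_le_self' (by simp) x
  let a : ℝ → ℝ≥0∞ := fun x => ∫⁻ y, F y ^ p * χ (x + y)
  have haN : ∀ x, a x ≤ N := fun x => lintegral_mono fun y => by
    simpa using mul_le_mul_right (hχ1 (x + y)) (F y ^ p)
  have ha_int : ∫⁻ x, a x = N * volume S := by
    simp only [a]
    rw [lintegral_lintegral_swap]
    · have : ∀ y, ∫⁻ x, F y ^ p * χ (x + y) = F y ^ p * volume S := by
        intro y
        rw [lintegral_const_mul _ (by fun_prop), lintegral_add_right_eq_self χ y]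
        simp [χ, hS]
      simp_rw [this]
      rw [lintegral_mul_const _ (by fun_prop)]
    · fun_prop
  have hpt : ∀ x, (∫⁻ y, F y * Φ (x + y)) ^ q ≤ C * N ^ (q / p - 1) * a x := by
    intro x
    have h1 : ∫⁻ y, F y * Φ (x + y) ≤ (a x) ^ (1 / p) * C ^ (1 / q) := by
      have h := ENNReal.lintegral_mul_le_Lp_mul_Lq volume hpq
        (f := fun y => F y * χ (x + y)) (g := fun y => Φ (x + y))
        (by fun_prop) (by fun_prop)
      have e1 : ∀ y, F y * χ (x + y) * Φ (x + y) = F y * Φ (x + y) := by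
        intro y
        by_cases hy : x + y ∈ S
        · simp [χ, hy]
        · simp [hsupp _ hy]
      have e2 : ∀ y, (F y * χ (x + y)) ^ p = F y ^ p * χ (x + y) := by
        intro y
        by_cases hy : x + y ∈ S
        · simp [χ, hy]
        · simp [χ, hy, hp0]
      have e3 : ∫⁻ y, Φ (x + y) ^ q = C := lintegral_add_left_eq_self (fun z => Φ z ^ q) x
      simp only [Pi.mul_apply, e1, e2, e3] at h
      exact h
    calc (∫⁻ y, F y * Φ (x + y)) ^ q ≤ ((a x) ^ (1 / p) * C ^ (1 / q)) ^ q := by gcongr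
      _ = a x ^ (q / p) * C := by
        rw [ENNReal.mul_rpow_of_nonneg _ _ hq0.le, ← ENNReal.rpow_mul, ← ENNReal.rpow_mul]
        congr 2
        · ring
        · rw [one_div_mul_cancel hq0.ne', ENNReal.rpow_one]
      _ = a x ^ (q / p - 1) * a x * C := by
        congr 1
        have h1 : 0 ≤ q / p - 1 := by
          rw [sub_nonneg, one_le_div hp0]; exact hle
        conv_lhs => rw [show q / p = (q / p - 1) + 1 by ring]
        rw [ENNReal.rpow_add_of_nonneg _ _ h1 zero_le_one, ENNReal.rpow_one]
      _ ≤ N ^ (q / p - 1) * a x * C := by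
        have h1 : 0 ≤ q / p - 1 := by
          rw [sub_nonneg, one_le_div hp0]; exact hle
        gcongr
        exact haN x
      _ = C * N ^ (q / p - 1) * a x := by ring
  have hKfin : C * N ^ (q / p - 1) ≠ ⊤ := by
    have h1 : 0 ≤ q / p - 1 := by
      rw [sub_nonneg, one_le_div hp0]; exact hle
    exact ENNReal.mul_ne_top hΦq (ENNReal.rpow_ne_top_of_nonneg h1 hFp)
  refine ne_top_of_le_ne_top ?_ (lintegral_mono hpt)
  rw [lintegral_const_mul' _ _ hKfin, ha_int]
  exact ENNReal.mul_ne_top hKfin (ENNReal.mul_ne_top hFp hSfin)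

lemma aux_young' {p q : ℝ} (hpq : p.HolderConjugate q) (hle : p ≤ q)
    (f : ℝ → ℂ) (hf : StronglyMeasurable f) (hfp : MemLp f (ENNReal.ofReal p) volume)
    (φ : ℝ → ℝ) (hφ : Continuous φ) (hφc : HasCompactSupport φ) :
    ∫⁻ x, (∫⁻ y, ‖f y‖ₑ * ‖φ (x + y)‖ₑ) ^ q ≠ ⊤ := by
  have hp0 : 0 < p := hpq.pos
  have hq0 : 0 < q := hpq.symm.pos
  refine aux_young hpq hle (fun y => ‖f y‖ₑ) (fun y => ‖φ y‖ₑ) hf.enorm hφ.measurable.enorm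
    (tsupport φ) (isClosed_tsupport φ).measurableSet hφc.measure_lt_top.ne ?_ ?_ ?_
  · intro x hx
    simp [image_eq_zero_of_notMem_tsupport hx]
  · have := (eLpNorm_lt_top_iff_lintegral_rpow_enorm_lt_top (by simpa using hp0) (by simp)).1 hfp.2
    rw [ENNReal.toReal_ofReal hp0.le] at this
    exact this.ne
  · have := (eLpNorm_lt_top_iff_lintegral_rpow_enorm_lt_top (by simpa using hq0) (by simp)).1
      (hφ.memLp_of_hasCompactSupport (p := ENNReal.ofReal q) (μ := volume) hφc).2
    rw [ENNReal.toReal_ofReal hq0.le] at this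
    exact this.ne

/-- The annihilating function. -/
noncomputable def annih (E f : ℝ → ℂ) (φ : ℝ → ℝ) (x : ℝ) : ℂ :=
  ∫ y, f y * (E y - E x) * (φ (x + y) : ℂ)

lemma annih_enorm_le (E f : ℝ → ℂ) (φ : ℝ → ℝ) (hE : ∀ x, ‖E x‖ = 1) (x : ℝ) :
    ‖annih E f φ x‖ₑ ≤ 2 * ∫⁻ y, ‖f y‖ₑ * ‖φ (x + y)‖ₑ := by
  refine (enorm_integral_le_lintegral_enorm _).trans ?_
  rw [← lintegral_const_mul' _ _ (by simp)]
  refine lintegral_mono fun y => ?_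
  have h2 : ‖E y - E x‖ₑ ≤ 2 := by
    refine (enorm_sub_le (a := E y) (b := E x)).trans ?_
    rw [← ofReal_norm, ← ofReal_norm, hE, hE]
    norm_num
  have h3 : ‖(φ (x + y) : ℂ)‖ₑ = ‖φ (x + y)‖ₑ := by
    rw [← ofReal_norm, ← ofReal_norm, Complex.norm_real]
  rw [enorm_mul, enorm_mul, h3]
  calc ‖f y‖ₑ * ‖E y - E x‖ₑ * ‖φ (x + y)‖ₑ ≤ ‖f y‖ₑ * 2 * ‖φ (x + y)‖ₑ := by gcongr
    _ = 2 * (‖f y‖ₑ * ‖φ (x + y)‖ₑ) := by ring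

lemma annih_continuous (E f : ℝ → ℂ) (φ : ℝ → ℝ) (hEc : Continuous E)
    (hf : LocallyIntegrable f volume)
    (hφ : Continuous φ) (hφc : HasCompactSupport φ) : Continuous (annih E f φ) := by
  let ψ : ℝ → ℂ := fun z => (φ (-z) : ℂ)
  have hψ : Continuous ψ := by fun_prop
  have hψc : HasCompactSupport ψ := by
    have h1 : HasCompactSupport (fun z => φ (-z)) := hφc.comp_homeomorph (Homeomorph.neg ℝ)
    exact h1.comp_left (g := fun r : ℝ => (r : ℂ)) (by simp)
  have key : ∀ g : ℝ → ℂ, LocallyIntegrable g volume →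
      Continuous (fun x => ∫ y, g y * (φ (x + y) : ℂ)) := by
    intro g hg
    have h := (hψc.continuous_convolution_right (ContinuousLinearMap.mul ℂ ℂ) hg hψ).comp
      continuous_neg
    convert h using 1
    ext x
    simp only [Function.comp, convolution, ψ, ContinuousLinearMap.mul_apply']
    congr 1; ext y; congr 3; ring
  have hfE : LocallyIntegrable (fun y => E y * f y) volume := by
    have := hf.continuous_smul hEc 
    simpa using this
  have hint : ∀ g : ℝ → ℂ, LocallyIntegrable g volume → ∀ x,
      Integrable (fun y => g y * (φ (x + y) : ℂ)) volume := by
    intro g hg x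
    have h1 : HasCompactSupport (fun y => φ (x + y)) := hφc.comp_homeomorph (Homeomorph.addLeft x)
    have h2 : HasCompactSupport (fun y => (φ (x + y) : ℂ)) :=
      h1.comp_left (g := fun r : ℝ => (r : ℂ)) (by simp)
    have := hg.integrable_smul_left_of_hasCompactSupport (g := fun y => (φ (x + y) : ℂ))
      (by fun_prop) h2
    simpa [mul_comm] using this
  have heq : annih E f φ = fun x => (∫ y, (E y * f y) * (φ (x + y) : ℂ))
      - E x * ∫ y, f y * (φ (x + y) : ℂ) := by
    ext x
    rw [← integral_const_mul, ← integral_sub (hint _ hfE x) ((hint _ hf x).const_mul _)]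
    unfold annih
    congr 1; ext y; ring
  rw [heq]
  exact (key _ hfE).sub (hEc.mul (key _ hf))

lemma annih_memLp {p q : ℝ} (hpq : p.HolderConjugate q) (hle : p ≤ q)
    (E f : ℝ → ℂ) (hE : ∀ x, ‖E x‖ = 1) (hEc : Continuous E)
    (hf : StronglyMeasurable f) (hfp : MemLp f (ENNReal.ofReal p) volume)
    (φ : ℝ → ℝ) (hφ : Continuous φ) (hφc : HasCompactSupport φ) :
    MemLp (annih E f φ) (ENNReal.ofReal q) volume := by
  have hq0 : 0 < q := hpq.symm.pos
  have hli : LocallyIntegrable f volume := hfp.locallyIntegrable (by simpa using hpq.lt.le)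
  refine ⟨(annih_continuous E f φ hEc hli hφ hφc).aestronglyMeasurable, ?_⟩
  rw [eLpNorm_lt_top_iff_lintegral_rpow_enorm_lt_top (by simpa using hq0) (by simp),
    ENNReal.toReal_ofReal hq0.le]
  have h := aux_young' hpq hle f hf hfp φ hφ hφc
  calc ∫⁻ x, ‖annih E f φ x‖ₑ ^ q
      ≤ ∫⁻ x, 2 ^ q * (∫⁻ y, ‖f y‖ₑ * ‖φ (x + y)‖ₑ) ^ q := by
        refine lintegral_mono fun x => ?_
        rw [← ENNReal.mul_rpow_of_nonneg _ _ hq0.le]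
        exact ENNReal.rpow_le_rpow (annih_enorm_le E f φ hE x) hq0.le
    _ = 2 ^ q * ∫⁻ x, (∫⁻ y, ‖f y‖ₑ * ‖φ (x + y)‖ₑ) ^ q :=
        lintegral_const_mul' _ _ (ENNReal.rpow_ne_top_of_nonneg hq0.le (by simp))
    _ < ⊤ := (ENNReal.mul_ne_top (ENNReal.rpow_ne_top_of_nonneg hq0.le (by simp)) h).lt_top

lemma annih_translate {p q : ℝ} (hpq : p.HolderConjugate q) (hle : p ≤ q)
    (E f : ℝ → ℂ) (hE : ∀ x, ‖E x‖ = 1) (hEc : Continuous E)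
    (hf : StronglyMeasurable f) (hfp : MemLp f (ENNReal.ofReal p) volume)
    (φ : ℝ → ℝ) (hφ : Continuous φ) (hφc : HasCompactSupport φ)
    (c : ℝ) (hper : ∀ x, E (x + c) = E x) :
    ∫ x, f (x - c) * annih E f φ x = 0 := by
  have hp0 : 0 < p := hpq.pos
  have hq0 : 0 < q := hpq.symm.pos
  have hfm := hf.measurable
  let G : ℝ → ℝ → ℂ := fun u y => f u * (f y * (E y - E u) * (φ (u + c + y) : ℂ))
  have h1 : ∫ x, f (x - c) * annih E f φ x = ∫ u, ∫ y, G u y := by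
    rw [← integral_add_right_eq_self _ c]
    congr 1; ext u
    simp only [G, annih, add_sub_cancel_right, hper]
    rw [integral_const_mul]
  have hφ' : Continuous (fun z => φ (z + c)) := by fun_prop
  have hφc' : HasCompactSupport (fun z => φ (z + c)) :=
    hφc.comp_homeomorph (Homeomorph.addRight c)
  have hG : Integrable (Function.uncurry G) (volume.prod volume) := by
    refine ⟨?_, ?_⟩
    · refine Measurable.aestronglyMeasurable ?_
      unfold G Function.uncurry
      fun_prop
    · rw [hasFiniteIntegral_iff_enorm, lintegral_prod]
      · have hb : ∀ u, ∫⁻ y, ‖G u y‖ₑ ≤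
            2 * (‖f u‖ₑ * ∫⁻ y, ‖f y‖ₑ * ‖φ (u + y + c)‖ₑ) := by
          intro u
          rw [← lintegral_const_mul' _ _ (by simp), ← lintegral_const_mul' _ _ (by simp)]
          refine lintegral_mono fun y => ?_
          have h2 : ‖E y - E u‖ₑ ≤ 2 := by
            refine (enorm_sub_le (a := E y) (b := E u)).trans ?_
            rw [← ofReal_norm, ← ofReal_norm, hE, hE]
            norm_num
          have h3 : ‖(φ (u + c + y) : ℂ)‖ₑ = ‖φ (u + y + c)‖ₑ := by
            rw [← ofReal_norm, ← ofReal_norm, Complex.norm_real, add_right_comm]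
          simp only [G]
          rw [enorm_mul, enorm_mul, enorm_mul, h3]
          calc ‖f u‖ₑ * (‖f y‖ₑ * ‖E y - E u‖ₑ * ‖φ (u + y + c)‖ₑ)
              ≤ ‖f u‖ₑ * (‖f y‖ₑ * 2 * ‖φ (u + y + c)‖ₑ) := by gcongr
            _ = _ := by ring
        refine (lintegral_mono hb).trans_lt ?_
        rw [lintegral_const_mul' _ _ (by simp)]
        refine ENNReal.mul_lt_top (by simp) ?_
        have hm : Measurable (fun u => ∫⁻ y, ‖f y‖ₑ * ‖φ (u + y + c)‖ₑ) := by
          refine Measurable.lintegral_prod_right' (f := fun z : ℝ × ℝ =>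
            ‖f z.2‖ₑ * ‖φ (z.1 + z.2 + c)‖ₑ) ?_
          have hφm : Measurable (fun z : ℝ × ℝ => φ (z.1 + z.2 + c)) :=
            Continuous.measurable (by fun_prop)
          exact (hfm.comp measurable_snd).enorm.mul hφm.enorm
        refine (ENNReal.lintegral_mul_le_Lp_mul_Lq volume hpq
          (f := fun u => ‖f u‖ₑ) (g := fun u => ∫⁻ y, ‖f y‖ₑ * ‖φ (u + y + c)‖ₑ)
          (by fun_prop) hm.aemeasurable).trans_lt ?_
        have h4 := (eLpNorm_lt_top_iff_lintegral_rpow_enorm_lt_top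
          (by simpa using hp0) (by simp)).1 hfp.2
        rw [ENNReal.toReal_ofReal hp0.le] at h4
        have h5 := aux_young' hpq hle f hf hfp _ hφ' hφc'
        exact ENNReal.mul_lt_top
          (ENNReal.rpow_lt_top_of_nonneg (by positivity) h4.ne)
          (ENNReal.rpow_lt_top_of_nonneg (by positivity) h5)
      · refine Measurable.aemeasurable ?_
        unfold G Function.uncurry
        fun_prop
  have h2 : ∫ u, ∫ y, G u y = - ∫ u, ∫ y, G u y := by
    conv_lhs => rw [integral_integral_swap hG]
    rw [← integral_neg]
    congr 1; ext u
    rw [← integral_neg]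
    congr 1; ext y
    simp only [G]
    rw [show y + c + u = u + c + y by ring]
    ring
  rw [h1]
  exact self_eq_neg.1 h2

open scoped ContDiff

theorem closed_span_lattice_translates_ne_top
    (p : ℝ) (hp : 1 < p) (hp2 : p ≤ 2)
    [Fact (1 ≤ ENNReal.ofReal p)]
    (f : Lp ℂ (ENNReal.ofReal p) (volume : Measure ℝ))
    (lam : ℝ) (hlam : 0 < lam) :
    closure (Submodule.span ℂ {g : Lp ℂ (ENNReal.ofReal p) (volume : Measure ℝ) |
        ∃ n : ℤ, (g : ℝ → ℂ) =ᵐ[volume] fun x => f (x - lam * n)} :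
      Set (Lp ℂ (ENNReal.ofReal p) (volume : Measure ℝ))) ≠ Set.univ := by
  intro htop
  set q := Real.conjExponent p with hq
  have hpq : p.HolderConjugate q := Real.HolderConjugate.conjExponent hp
  have hle : p ≤ q := by
    rw [hq, Real.conjExponent, le_div_iff₀ (by linarith)]
    nlinarith
  have : ENNReal.HolderConjugate (ENNReal.ofReal p) (ENNReal.ofReal q) := hpq.ennrealOfReal
  have : Fact (1 ≤ ENNReal.ofReal q) := ⟨by simpa using hpq.symm.lt.le⟩
  have hfm : StronglyMeasurable f := Lp.stronglyMeasurable f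
  have hfp : MemLp f (ENNReal.ofReal p) volume := Lp.memLp f
  have hli : LocallyIntegrable f volume := hfp.locallyIntegrable Fact.out
  let E : ℝ → ℂ := fun x => Complex.exp ((2 * Real.pi * x / lam : ℝ) * Complex.I)
  have hE : ∀ x, ‖E x‖ = 1 := fun x => Complex.norm_exp_ofReal_mul_I _
  have hEc : Continuous E := by fun_prop
  have hper : ∀ (n : ℤ) x, E (x + lam * n) = E x := by
    intro n x
    refine Complex.exp_eq_exp_iff_exists_int.2 ⟨n, ?_⟩
    have : (lam : ℂ) ≠ 0 := by exact_mod_cast hlam.ne'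
    push_cast
    field_simp
  have hann : ∀ φ : ℝ → ℝ, ContDiff ℝ ∞ φ → HasCompactSupport φ → annih E f φ 0 = 0 := by
    intro φ hφd hφc
    have hφ := hφd.continuous
    have hc := annih_continuous E f φ hEc hli hφ hφc
    have hm := annih_memLp hpq hle E f hE hEc hfm hfp φ hφ hφc
    let ℓ := ((ContinuousLinearMap.mul ℂ ℂ).lpPairing volume
      (ENNReal.ofReal p) (ENNReal.ofReal q)).flip (hm.toLp _)
    have hℓ : ∀ w : Lp ℂ (ENNReal.ofReal p) (volume : Measure ℝ),
        ℓ w = ∫ x, w x * annih E f φ x := by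
      intro w
      simp only [ℓ, ContinuousLinearMap.flip_apply, ContinuousLinearMap.lpPairing_eq_integral,
        ContinuousLinearMap.mul_apply']
      refine integral_congr_ae ?_
      filter_upwards [hm.coeFn_toLp] with x hx
      rw [hx]
    have hspan : Submodule.span ℂ {g : Lp ℂ (ENNReal.ofReal p) (volume : Measure ℝ) |
        ∃ n : ℤ, (g : ℝ → ℂ) =ᵐ[volume] fun x => f (x - lam * n)} ≤ ℓ.ker := by
      rw [Submodule.span_le]
      rintro g ⟨n, hn⟩
      change ℓ g = 0
      rw [hℓ, ← annih_translate hpq hle E f hE hEc hfm hfp φ hφ hφc (lam * n) (hper n)]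
      refine integral_congr_ae ?_
      filter_upwards [hn] with x hx
      rw [hx]
    have hall : ∀ w, ℓ w = 0 := by
      intro w
      have h1 : w ∈ closure (Submodule.span ℂ
          {g : Lp ℂ (ENNReal.ofReal p) (volume : Measure ℝ) |
            ∃ n : ℤ, (g : ℝ → ℂ) =ᵐ[volume] fun x => f (x - lam * n)} :
          Set (Lp ℂ (ENNReal.ofReal p) (volume : Measure ℝ))) := by
        rw [htop]; trivial
      exact closure_minimal hspan ℓ.isClosed_ker h1
    have hae : ∀ᵐ x, annih E f φ x = 0 := by
      refine ae_eq_zero_of_integral_contDiff_smul_eq_zero hc.locallyIntegrable ?_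
      intro g hg hgc
      have hgc' : HasCompactSupport (fun x => (g x : ℂ)) :=
        hgc.comp_left (g := fun r : ℝ => (r : ℂ)) (by simp)
      have hgm : MemLp (fun x => (g x : ℂ)) (ENNReal.ofReal p) volume :=
        (Complex.continuous_ofReal.comp hg.continuous).memLp_of_hasCompactSupport hgc'
      rw [← hall (hgm.toLp _), hℓ]
      refine integral_congr_ae ?_
      filter_upwards [hgm.coeFn_toLp] with x hx
      rw [hx, Complex.real_smul]
    have : annih E f φ = fun _ => 0 := (hc.ae_eq_iff_eq volume continuous_const).1 hae
    rw [this]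
  -- hence `f = 0`
  have hf0 : ∀ᵐ y, f y * (E y - E 0) = 0 := by
    refine ae_eq_zero_of_integral_contDiff_smul_eq_zero ?_ ?_
    · have := hli.continuous_smul (g := fun y => E y - E 0) (by fun_prop)
      simpa [mul_comm] using this
    · intro φ hφ hφc
      rw [← hann φ hφ hφc]
      unfold annih
      congr 1; ext y
      rw [Complex.real_smul, zero_add, mul_comm]
  have hE0 : ∀ᵐ y : ℝ, E y - E 0 ≠ 0 := by
    have hcount : (Set.range fun n : ℤ => (n : ℝ) * lam).Countable := Set.countable_range _
    filter_upwards [hcount.ae_notMem volume] with y hy h0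
    apply hy
    obtain ⟨n, hn⟩ := Complex.exp_eq_exp_iff_exists_int.1 (sub_eq_zero.1 h0)
    refine ⟨n, ?_⟩
    have hl : (lam : ℂ) ≠ 0 := by exact_mod_cast hlam.ne'
    have hπ : (Real.pi : ℂ) ≠ 0 := by exact_mod_cast Real.pi_ne_zero
    have hI := Complex.I_ne_zero
    push_cast at hn
    field_simp at hn
    have hn' : (y : ℂ) = n * lam := by linear_combination hn
    have : y = n * lam := by exact_mod_cast hn'
    exact this.symm
  have hf00 : ∀ᵐ y, f y = 0 := by
    filter_upwards [hf0, hE0] with y h1 h2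
    exact (mul_eq_zero.1 h1).resolve_right h2
  have hsub : Submodule.span ℂ {g : Lp ℂ (ENNReal.ofReal p) (volume : Measure ℝ) |
        ∃ n : ℤ, (g : ℝ → ℂ) =ᵐ[volume] fun x => f (x - lam * n)} ≤ ⊥ := by
    rw [Submodule.span_le]
    rintro g ⟨n, hn⟩
    have h0 : ∀ᵐ x, f (x - lam * n) = 0 :=
      (measurePreserving_sub_right volume (lam * n)).quasiMeasurePreserving.ae hf00
    have : g = 0 := by
      rw [Lp.eq_zero_iff_ae_eq_zero]
      filter_upwards [hn, h0] with x h1 h2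
      rw [h1, h2]; rfl
    simp [this]
  have hcl : ∀ w : Lp ℂ (ENNReal.ofReal p) (volume : Measure ℝ), w = 0 := by
    intro w
    have h1 := closure_mono (show _ ⊆ ({0} : Set (Lp ℂ (ENNReal.ofReal p) (volume : Measure ℝ)))
      from hsub) (htop ▸ Set.mem_univ w)
    simpa using h1
  have h1 := hcl (indicatorConstLp (ENNReal.ofReal p) (s := Set.Icc (0 : ℝ) 1)
    measurableSet_Icc (by simp) (1 : ℂ))
  have h2 := norm_indicatorConstLp (p := ENNReal.ofReal p) (μ := volume) (s := Set.Icc (0 : ℝ) 1)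
    (hs := measurableSet_Icc) (hμs := by simp) (c := (1 : ℂ))
    (by simpa using (by linarith : (0:ℝ) < p)) (by simp)
  rw [h1] at h2
  simp at h2
end
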